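/- Let γ̂₁, γ̂₂ be ultraparallel complete geodesics of H² with dist(γ̂₁,γ̂₂) < dist(η̂₁,η̂₂), where η̂₁, η̂₂ are the other two sides of the ideal quadrilateral Ω̂ they determine. Let Ω₀ ⊂ Ω̂ be the regular compact quadrilateral with sides γ′₁⊂γ̂₁, γ′₂⊂γ̂₂ and η′₁, η′₂ orthogonal to the common perpendicular η̂₁₂ of η̂₁ and η̂₂, all four sides at equal distance dist(O,γ̂₁) from the center O, so that ℓ(γ′₁)+ℓ(γ′₂) = ℓ(η′₁)+ℓ(η′₂). Then every quadrilateral domain Ω bounded by compact geodesic arcs γᵢ ⊂ γ̂ᵢ (i=1,2) and compact geodesic arcs η₁, η₂, such that Ω₀ is strictly contained in Ω, satisfies ℓ(γ₁)+ℓ(γ₂) > ℓ(η₁)+ℓ(η₂). -/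

import Mathlib

noncomputable section

open Set MeasureTheory Topology Filter

/-- Points of the cylinder model: a horizontal complex coordinate and a vertical real one. -/
abbrev Pt : Type := ℂ × ℝ

/-! ### The hyperbolic plane: disk of radius 2 with the curvature −1 metric
`λ²(dx²+dy²)`, `λ = 4/(4−(x²+y²))`. -/

/-- The underlying set of the disk model of `H²`. -/
def hDisk : Set ℂ := {w | Complex.normSq w < 4}

/-- Inverse hyperbolic cosine. -/
def arcosh (x : ℝ) : ℝ := Real.log (x + Real.sqrt (x ^ 2 - 1))

/-- Hyperbolic distance on the disk of radius 2 (curvature −1). -/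
def hDist (w₁ w₂ : ℂ) : ℝ :=
  arcosh (1 + 8 * Complex.normSq (w₁ - w₂) /
    ((4 - Complex.normSq w₁) * (4 - Complex.normSq w₂)))

/-- The hyperbolic Riemannian inner product of tangent vectors `v₁ v₂` at `w`. -/
def hInner (w v₁ v₂ : ℂ) : ℝ :=
  (4 / (4 - Complex.normSq w)) ^ 2 * (v₁.re * v₂.re + v₁.im * v₂.im)

/-- Hyperbolic distance between two subsets of `H²`. -/
def setDistH (A B : Set ℂ) : ℝ := sInf {d | ∃ p ∈ A, ∃ q ∈ B, d = hDist p q}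

/-- A complete geodesic of `H²`: the image of an isometric embedding of `ℝ`. -/
def IsCompleteGeodesic (G : Set ℂ) : Prop :=
  ∃ γ : ℝ → ℂ, (∀ t, γ t ∈ hDisk) ∧ (∀ s t, hDist (γ s) (γ t) = |s - t|) ∧ G = Set.range γ

/-- A geodesic half-line issuing from the point `O`. -/
def IsGeodesicRayFrom (R : Set ℂ) (O : ℂ) : Prop :=
  ∃ γ : ℝ → ℂ, (∀ t, γ t ∈ hDisk) ∧
    (∀ s t, 0 ≤ s → 0 ≤ t → hDist (γ s) (γ t) = |s - t|) ∧ γ 0 = O ∧ R = γ '' Set.Ici 0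

/-- An open geodesic arc with endpoints `p` and `q` (endpoints excluded). -/
def IsGeodesicArc (A : Set ℂ) (p q : ℂ) : Prop :=
  ∃ γ : ℝ → ℂ, (∀ t, γ t ∈ hDisk) ∧ (∀ s t, hDist (γ s) (γ t) = |s - t|) ∧
    ∃ L : ℝ, 0 < L ∧ γ 0 = p ∧ γ L = q ∧ A = γ '' Set.Ioo 0 L

/-- The ideal (at infinity) points of a subset of `H²`. -/
def idealPoints (G : Set ℂ) : Set ℂ := closure G \ hDisk

/-- Two complete geodesics are ultraparallel iff they have no common point,
even at infinity. -/
def Ultraparallel (G₁ G₂ : Set ℂ) : Prop := closure G₁ ∩ closure G₂ = ∅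

/-- Hyperbolic convexity. -/
def HConvex (Ω : Set ℂ) : Prop := ∀ p ∈ Ω, ∀ q ∈ Ω, ∀ A : Set ℂ, IsGeodesicArc A p q → A ⊆ Ω

/-- Two complete geodesics meeting perpendicularly. -/
def PerpGeodesics (A B : Set ℂ) : Prop :=
  ∃ (x : ℂ) (γa γb : ℝ → ℂ),
    (∀ t, γa t ∈ hDisk) ∧ (∀ s t, hDist (γa s) (γa t) = |s - t|) ∧ A = Set.range γa ∧
    (∀ t, γb t ∈ hDisk) ∧ (∀ s t, hDist (γb s) (γb t) = |s - t|) ∧ B = Set.range γb ∧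
    γa 0 = x ∧ γb 0 = x ∧ hInner x (deriv γa 0) (deriv γb 0) = 0

/-- A bounded convex quadrilateral domain of `H²` with sides (open geodesic arcs)
`g₁, e₁, g₂, e₂` in this order and vertices `p₁, q₁, p₂, q₂` in this order. -/
structure IsQuadrilateral (Ω g₁ e₁ g₂ e₂ : Set ℂ) (p₁ q₁ p₂ q₂ : ℂ) : Prop where
  isOpen : IsOpen Ω
  inDisk : closure Ω ⊆ hDisk
  convex : HConvex Ω
  sideg₁ : IsGeodesicArc g₁ p₁ q₁
  sidee₁ : IsGeodesicArc e₁ q₁ p₂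
  sideg₂ : IsGeodesicArc g₂ p₂ q₂
  sidee₂ : IsGeodesicArc e₂ q₂ p₁
  bdry : frontier Ω = g₁ ∪ e₁ ∪ g₂ ∪ e₂ ∪ {p₁, q₁, p₂, q₂}

/-- An ideal quadrilateral domain of `H²` whose boundary consists of the four
complete geodesics `G₁, H₁, G₂, H₂` in this order, with distinct ideal vertices
`p₁, q₁, p₂, q₂` in this order. -/
structure IsIdealQuadrilateral (Ω G₁ H₁ G₂ H₂ : Set ℂ) (p₁ q₁ p₂ q₂ : ℂ) : Prop where
  isOpen : IsOpen Ω
  subset : Ω ⊆ hDisk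
  geo₁ : IsCompleteGeodesic G₁
  geoH₁ : IsCompleteGeodesic H₁
  geo₂ : IsCompleteGeodesic G₂
  geoH₂ : IsCompleteGeodesic H₂
  distinct : p₁ ≠ q₁ ∧ p₁ ≠ p₂ ∧ p₁ ≠ q₂ ∧ q₁ ≠ p₂ ∧ q₁ ≠ q₂ ∧ p₂ ≠ q₂
  ends₁ : idealPoints G₁ = {p₁, q₁}
  endsH₁ : idealPoints H₁ = {q₁, p₂}
  ends₂ : idealPoints G₂ = {p₂, q₂}
  endsH₂ : idealPoints H₂ = {q₂, p₁}
  bdry : frontier Ω ∩ hDisk = G₁ ∪ H₁ ∪ G₂ ∪ H₂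
  convex : HConvex Ω

/-! ### The ambient homogeneous spaces `E³(κ,τ)`; `PSL~₂(ℝ,τ) = E³(−1,τ)`.
The metric is `λ²(dx²+dy²) + (τλ(y dx − x dy) + dz)²` with `λ = 1/(1+κ(x²+y²)/4)`. -/

def lamE (κ : ℝ) (p : Pt) : ℝ := 1 / (1 + κ * Complex.normSq p.1 / 4)

def spaceE (κ : ℝ) : Set Pt := {p | 0 < 1 + κ * Complex.normSq p.1 / 4}

/-- The Riemannian metric of `E³(κ,τ)` as a quadratic form on tangent vectors. -/
def quadE (κ τ : ℝ) (p v : Pt) : ℝ :=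
  (lamE κ p) ^ 2 * Complex.normSq v.1 +
    (τ * lamE κ p * (p.1.im * v.1.re - p.1.re * v.1.im) + v.2) ^ 2

/-- The polarization of `quadE`: the Riemannian inner product of `E³(κ,τ)`. -/
def innE (κ τ : ℝ) (p v w : Pt) : ℝ :=
  (quadE κ τ p (v + w) - quadE κ τ p v - quadE κ τ p w) / 2

/-- The cylinder model of `PSL~₂(ℝ,τ)`. -/
def pslSpace : Set Pt := spaceE (-1)

/-- The vertical cylinder `A × ℝ` over a subset `A` of `H²`. -/
def vert (A : Set ℂ) : Set Pt := A ×ˢ (Set.univ : Set ℝ)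

/-- The vertical slab `A × [a,b]`. -/
def vSlab (A : Set ℂ) (a b : ℝ) : Set Pt := A ×ˢ Set.Icc a b

/-- Vertical translation by `h` (an isometry of `E³(κ,τ)`). -/
def vTrans (h : ℝ) (p : Pt) : Pt := (p.1, p.2 + h)

/-- The boundary at infinity of the cylinder model. -/
def infBdry : Set Pt := {p | Complex.normSq p.1 = 4}

/-! ### Lengths and distances in `E³(κ,τ)` -/

/-- Length of the restriction of a curve to `[a,b]`. -/
def pathLen (κ τ : ℝ) (γ : ℝ → Pt) (a b : ℝ) : ℝ :=
  ∫ t in a..b, Real.sqrt (quadE κ τ (γ t) (deriv γ t))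

/-- Riemannian distance in `E³(κ,τ)`. -/
def ambDist (κ τ : ℝ) (p q : Pt) : ℝ :=
  sInf {L | ∃ γ : ℝ → Pt, ContDiff ℝ 1 γ ∧ γ 0 = p ∧ γ 1 = q ∧
    (∀ t, γ t ∈ spaceE κ) ∧ L = pathLen κ τ γ 0 1}

/-- Riemannian distance in `PSL~₂(ℝ,τ)`. -/
def pslDist (τ : ℝ) : Pt → Pt → ℝ := ambDist (-1) τ

/-- Intrinsic distance within a subset `S` of `E³(κ,τ)`. -/
def distIn (κ τ : ℝ) (S : Set Pt) (p q : Pt) : ℝ :=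
  sInf {L | ∃ γ : ℝ → Pt, ContDiff ℝ 1 γ ∧ γ 0 = p ∧ γ 1 = q ∧
    (∀ t ∈ Set.Icc (0:ℝ) 1, γ t ∈ S) ∧ L = pathLen κ τ γ 0 1}

/-! ### Area and minimality -/

/-- The Riemannian area element of a parametrized piece of surface. -/
def areaEl (κ τ : ℝ) (X : ℝ × ℝ → Pt) (u : ℝ × ℝ) : ℝ :=
  Real.sqrt (quadE κ τ (X u) (fderiv ℝ X u (1, 0)) * quadE κ τ (X u) (fderiv ℝ X u (0, 1)) -
    (innE κ τ (X u) (fderiv ℝ X u (1, 0)) (fderiv ℝ X u (0, 1))) ^ 2)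

/-- The Riemannian area of a parametrized piece of surface. -/
def pieceArea (κ τ : ℝ) (U : Set (ℝ × ℝ)) (X : ℝ × ℝ → Pt) : ℝ := ∫ u in U, areaEl κ τ X u

/-- `X : U → E³(κ,τ)` is a critical point of the area functional for all smooth,
compactly supported variations: this is minimality (vanishing mean curvature). -/
def IsCriticalPiece (κ τ : ℝ) (U : Set (ℝ × ℝ)) (X : ℝ × ℝ → Pt) : Prop :=
  (∀ u ∈ U, X u ∈ spaceE κ) ∧
  ∀ V : ℝ × ℝ → Pt, ContDiff ℝ (⊤ : ℕ∞) V → IsCompact (tsupport V) → tsupport V ⊆ U →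
    deriv (fun s : ℝ => pieceArea κ τ U (fun u => X u + s • V u)) 0 = 0

/-- A local chart exhibiting `S` as an embedded smooth surface near `p`. -/
def IsSurfaceChart (S : Set Pt) (U : Set (ℝ × ℝ)) (X : ℝ × ℝ → Pt) (u₀ : ℝ × ℝ) (p : Pt) :
    Prop :=
  IsOpen U ∧ u₀ ∈ U ∧ X u₀ = p ∧ ContDiffOn ℝ (⊤ : ℕ∞) X U ∧ Set.InjOn X U ∧
  (∀ u ∈ U, LinearIndependent ℝ ![fderiv ℝ X u (1, 0), fderiv ℝ X u (0, 1)]) ∧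
  ∃ W : Set Pt, IsOpen W ∧ p ∈ W ∧ S ∩ W = X '' U ∩ W

/-- `S` is an embedded minimal surface in `E³(κ,τ)` with boundary `B`. -/
def IsMinimalSurface (κ τ : ℝ) (S B : Set Pt) : Prop :=
  S ⊆ spaceE κ ∧ B ⊆ S ∧
  ∀ p ∈ S \ B, ∃ (U : Set (ℝ × ℝ)) (X : ℝ × ℝ → Pt) (u₀ : ℝ × ℝ),
    IsSurfaceChart S U X u₀ p ∧ IsCriticalPiece κ τ U X

/-- `S` is an immersed minimal surface in `E³(κ,τ)` with boundary `B`. -/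
def IsImmersedMinimal (κ τ : ℝ) (S B : Set Pt) : Prop :=
  S ⊆ spaceE κ ∧ B ⊆ S ∧
  ∀ p ∈ S \ B, ∃ (U : Set (ℝ × ℝ)) (X : ℝ × ℝ → Pt),
    IsOpen U ∧ ContDiffOn ℝ (⊤ : ℕ∞) X U ∧
    (∀ u ∈ U, LinearIndependent ℝ ![fderiv ℝ X u (1, 0), fderiv ℝ X u (0, 1)]) ∧
    IsCriticalPiece κ τ U X ∧ p ∈ X '' U ∧ X '' U ⊆ S

/-- `S` is closed in `A` (properness). -/
def ProperlyEmbeddedIn (S A : Set Pt) : Prop := closure S ∩ A ⊆ S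

/-! ### Topology of surfaces -/

/-- A complete (open) annulus. -/
def IsOpenAnnulus (S : Set Pt) : Prop := Nonempty (↥S ≃ₜ (ℝ × Circle))

/-- The standard compact planar annulus. -/
def aDom : Set ℂ := Metric.closedBall 0 2 \ Metric.ball 0 1

/-- A compact annulus `A` with the two boundary circles `B₁` and `B₂`. -/
def IsAnnulusWithBdry (A B₁ B₂ : Set Pt) : Prop :=
  ∃ f : ℂ → Pt, ContinuousOn f aDom ∧ Set.InjOn f aDom ∧ f '' aDom = A ∧
    f '' Metric.sphere 0 1 = B₁ ∧ f '' Metric.sphere 0 2 = B₂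

/-- A compact disk `D` with boundary circle `Bd`. -/
def IsDiskWithBdry (D Bd : Set Pt) : Prop :=
  ∃ f : ℂ → Pt, ContinuousOn f (Metric.closedBall 0 1) ∧
    Set.InjOn f (Metric.closedBall 0 1) ∧
    f '' Metric.closedBall 0 1 = D ∧ f '' Metric.sphere 0 1 = Bd

/-- A Jordan curve in the ambient space. -/
def IsJordanCurve (C : Set Pt) : Prop := IsCompact C ∧ Nonempty (↥C ≃ₜ Circle)

/-- A topological disk. -/
def IsTopDisk (S : Set Pt) : Prop := IsConnected S ∧ SimplyConnectedSpace ↥S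

/-! ### Tangent planes and tangency -/

/-- `S` has tangent plane `P` at the point `p`. -/
def HasTangentPlaneAt (S : Set Pt) (p : Pt) (P : Submodule ℝ Pt) : Prop :=
  ∃ (U : Set (ℝ × ℝ)) (X : ℝ × ℝ → Pt) (u₀ : ℝ × ℝ),
    IsSurfaceChart S U X u₀ p ∧
    P = Submodule.span ℝ {fderiv ℝ X u₀ (1, 0), fderiv ℝ X u₀ (0, 1)}

/-- Two surfaces are tangent at a point: same tangent plane there. -/
def TangentAt (S T : Set Pt) (p : Pt) : Prop :=
  ∃ P : Submodule ℝ Pt, HasTangentPlaneAt S p P ∧ HasTangentPlaneAt T p P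

/-- The horizontal plane of the model. -/
def horizPlane : Submodule ℝ Pt :=
  Submodule.span ℝ {((1 : ℂ), (0 : ℝ)), ((Complex.I : ℂ), (0 : ℝ))}

/-- A horizontal point of `S`: a critical point of the height function. -/
def IsHorizontalPointOf (S : Set Pt) (p : Pt) : Prop :=
  p ∈ S ∧ HasTangentPlaneAt S p horizPlane

/-- The largest height of horizontal points of `S`. -/
def hplus (S : Set Pt) : ℝ := sSup {z | ∃ p : Pt, IsHorizontalPointOf S p ∧ p.2 = z}

/-- The smallest height of horizontal points of `S`. -/
def hminus (S : Set Pt) : ℝ := sInf {z | ∃ p : Pt, IsHorizontalPointOf S p ∧ p.2 = z}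

/-! ### The second fundamental form in `E³(κ,τ)` -/

def bvec : Fin 3 → Pt := ![((1 : ℂ), (0 : ℝ)), ((Complex.I : ℂ), (0 : ℝ)), ((0 : ℂ), (1 : ℝ))]

def coords (v : Pt) : Fin 3 → ℝ := ![v.1.re, v.1.im, v.2]

/-- The metric of `E³(κ,τ)` in the coordinate frame. -/
def gmat (κ τ : ℝ) (p : Pt) : Matrix (Fin 3) (Fin 3) ℝ :=
  Matrix.of fun i j => innE κ τ p (bvec i) (bvec j)

def ginv (κ τ : ℝ) (p : Pt) : Matrix (Fin 3) (Fin 3) ℝ := (gmat κ τ p)⁻¹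

/-- Christoffel symbols `Γᵏᵢⱼ` of `E³(κ,τ)`. -/
def christoffel (κ τ : ℝ) (p : Pt) (i j k : Fin 3) : ℝ :=
  (1 / 2) * ∑ l : Fin 3, ginv κ τ p k l *
    (fderiv ℝ (fun q => gmat κ τ q j l) p (bvec i) +
     fderiv ℝ (fun q => gmat κ τ q i l) p (bvec j) -
     fderiv ℝ (fun q => gmat κ τ q i j) p (bvec l))

/-- Christoffel correction `Γ(v,w)` at `p`. -/
def gamVec (κ τ : ℝ) (p v w : Pt) : Pt :=
  ∑ k : Fin 3,
    (∑ i : Fin 3, ∑ j : Fin 3, coords v i * coords w j * christoffel κ τ p i j k) • bvec k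

/-- The ambient covariant Hessian `∇_{dX(a)} dX(b)` of a parametrized surface. -/
def covHess (κ τ : ℝ) (X : ℝ × ℝ → Pt) (u : ℝ × ℝ) (a b : ℝ × ℝ) : Pt :=
  fderiv ℝ (fun u' => fderiv ℝ X u' b) u a + gamVec κ τ (X u) (fderiv ℝ X u a) (fderiv ℝ X u b)

def eparam : Fin 2 → ℝ × ℝ := ![(1, 0), (0, 1)]

/-- The induced metric of a parametrized surface. -/
def smat (κ τ : ℝ) (X : ℝ × ℝ → Pt) (u : ℝ × ℝ) : Matrix (Fin 2) (Fin 2) ℝ :=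
  Matrix.of fun i j => innE κ τ (X u) (fderiv ℝ X u (eparam i)) (fderiv ℝ X u (eparam j))

def sinv (κ τ : ℝ) (X : ℝ × ℝ → Pt) (u : ℝ × ℝ) : Matrix (Fin 2) (Fin 2) ℝ := (smat κ τ X u)⁻¹

/-- Orthogonal projection on the tangent plane of the parametrized surface. -/
def tangProj (κ τ : ℝ) (X : ℝ × ℝ → Pt) (u : ℝ × ℝ) (v : Pt) : Pt :=
  ∑ i : Fin 2, ∑ j : Fin 2,
    (sinv κ τ X u i j * innE κ τ (X u) v (fderiv ℝ X u (eparam j))) • fderiv ℝ X u (eparam i)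

/-- The normal component of the covariant Hessian: the vector second fundamental form. -/
def sffVec (κ τ : ℝ) (X : ℝ × ℝ → Pt) (u : ℝ × ℝ) (i j : Fin 2) : Pt :=
  covHess κ τ X u (eparam i) (eparam j) - tangProj κ τ X u (covHess κ τ X u (eparam i) (eparam j))

/-- The squared norm `|A|²` of the second fundamental form of a parametrized surface. -/
def sffNormSq (κ τ : ℝ) (X : ℝ × ℝ → Pt) (u : ℝ × ℝ) : ℝ :=
  ∑ i : Fin 2, ∑ j : Fin 2, ∑ k : Fin 2, ∑ l : Fin 2,
    sinv κ τ X u i k * sinv κ τ X u j l *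
      innE κ τ (X u) (sffVec κ τ X u i j) (sffVec κ τ X u k l)

/-- The norm of the second fundamental form of the surface `S` at `p` equals `a`. -/
def SffNormAt (κ τ : ℝ) (S : Set Pt) (p : Pt) (a : ℝ) : Prop :=
  0 ≤ a ∧ ∃ (U : Set (ℝ × ℝ)) (X : ℝ × ℝ → Pt) (u₀ : ℝ × ℝ),
    IsSurfaceChart S U X u₀ p ∧ sffNormSq κ τ X u₀ = a ^ 2

/-- `|A_S| ≤ C` everywhere on `S`. -/
def CurvBoundedBy (κ τ : ℝ) (S : Set Pt) (C : ℝ) : Prop :=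
  ∀ p ∈ S, ∀ a : ℝ, SffNormAt κ τ S p a → a ≤ C

/-- Curvature bound valid for every immersed piece lying on `S`. -/
def ImmersedCurvBound (κ τ : ℝ) (S : Set Pt) (C : ℝ) : Prop :=
  ∀ (U : Set (ℝ × ℝ)) (X : ℝ × ℝ → Pt), IsOpen U → ContDiffOn ℝ (⊤ : ℕ∞) X U →
    (∀ u ∈ U, LinearIndependent ℝ ![fderiv ℝ X u (1, 0), fderiv ℝ X u (0, 1)]) →
    X '' U ⊆ S → ∀ u ∈ U, sffNormSq κ τ X u ≤ C ^ 2

/-! ### Annulus parametrizations and stability -/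

/-- A parametrization of a compact annulus (periodic in the first variable). -/
structure IsAnnulusParam (κ τ : ℝ) (X : ℝ × ℝ → Pt) : Prop where
  smooth : ContDiff ℝ (⊤ : ℕ∞) X
  periodic : ∀ s t : ℝ, X (s + 1, t) = X (s, t)
  inj : Set.InjOn X (Set.Ico (0 : ℝ) 1 ×ˢ Set.Icc (0 : ℝ) 1)
  inSpace : ∀ u : ℝ × ℝ, u.2 ∈ Set.Icc (0 : ℝ) 1 → X u ∈ spaceE κ
  immersed : ∀ u : ℝ × ℝ, u.2 ∈ Set.Icc (0 : ℝ) 1 →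
    LinearIndependent ℝ ![fderiv ℝ X u (1, 0), fderiv ℝ X u (0, 1)]

def annImage (X : ℝ × ℝ → Pt) : Set Pt := X '' ((Set.univ : Set ℝ) ×ˢ Set.Icc (0 : ℝ) 1)

def annBdry (X : ℝ × ℝ → Pt) : Set Pt := X '' ((Set.univ : Set ℝ) ×ˢ ({0, 1} : Set ℝ))

def annArea (κ τ : ℝ) (X : ℝ × ℝ → Pt) : ℝ :=
  pieceArea κ τ (Set.Ioo (0 : ℝ) 1 ×ˢ Set.Icc (0 : ℝ) 1) X

/-- An admissible variation of an annulus: smooth, periodic, vanishing on the boundary. -/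
def AdmissibleVar (V : ℝ × ℝ → Pt) : Prop :=
  ContDiff ℝ (⊤ : ℕ∞) V ∧ (∀ s t : ℝ, V (s + 1, t) = V (s, t)) ∧
    ∀ s : ℝ, V (s, 0) = 0 ∧ V (s, 1) = 0

/-- The second variation of area of an annulus in the direction `V`. -/
def annSecondVar (κ τ : ℝ) (X V : ℝ × ℝ → Pt) : ℝ :=
  iteratedDeriv 2 (fun s : ℝ => annArea κ τ (fun u => X u + s • V u)) 0

/-- A compact minimal annulus in `PSL~₂(ℝ,τ)` with boundary `B`. -/
def MinAnnulus (τ : ℝ) (S B : Set Pt) : Prop :=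
  IsMinimalSurface (-1) τ S B ∧
  ∃ X : ℝ × ℝ → Pt, IsAnnulusParam (-1) τ X ∧ annImage X = S ∧ annBdry X = B

/-- Stability: nonnegative second variation (first eigenvalue of the Jacobi operator `≥ 0`). -/
def StableAnnulus (τ : ℝ) (S B : Set Pt) : Prop :=
  ∃ X : ℝ × ℝ → Pt, IsAnnulusParam (-1) τ X ∧ annImage X = S ∧ annBdry X = B ∧
    ∀ V : ℝ × ℝ → Pt, AdmissibleVar V → 0 ≤ annSecondVar (-1) τ X V

/-- Strict stability: positive second variation for nonzero variations. -/
def StrictlyStableAnnulus (τ : ℝ) (S B : Set Pt) : Prop :=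
  ∃ X : ℝ × ℝ → Pt, IsAnnulusParam (-1) τ X ∧ annImage X = S ∧ annBdry X = B ∧
    ∀ V : ℝ × ℝ → Pt, AdmissibleVar V → (∃ u : ℝ × ℝ, u.2 ∈ Set.Icc (0 : ℝ) 1 ∧ V u ≠ 0) →
      0 < annSecondVar (-1) τ X V

/-- Stable-unstable: first eigenvalue of the Jacobi operator equal to `0`. -/
def StableUnstableAnnulus (τ : ℝ) (S B : Set Pt) : Prop :=
  StableAnnulus τ S B ∧ ¬ StrictlyStableAnnulus τ S B

/-! ### The smoothed boundary curves `Γⁱₙ` -/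

/-- The boundary of the rectangle `γ × [−n, n]` (arc `g` with endpoints `p, q`). -/
def rectBdry (g : Set ℂ) (p q : ℂ) (n : ℝ) : Set Pt :=
  ((g ∪ {p, q}) ×ˢ ({-n, n} : Set ℝ)) ∪ (({p, q} : Set ℂ) ×ˢ Set.Icc (-n) n)

/-- The family of smooth closed convex curves obtained by smoothing the corners of
`∂(γ×[−n,n])` in the same manner for all `n`. -/
structure SmoothedBoundary (g : Set ℂ) (p q : ℂ) (Γ : ℕ → Set Pt) : Prop where
  jordan : ∀ n, 1 ≤ n → IsJordanCurve (Γ n)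
  inside : ∀ n, 1 ≤ n → Γ n ⊆ (g ∪ {p, q}) ×ˢ Set.Icc (-(n : ℝ)) (n : ℝ)
  close : ∃ r : ℝ, 0 < r ∧ r < 1 ∧ ∀ n, 1 ≤ n →
    (∀ x ∈ Γ n, ∃ y ∈ rectBdry g p q (n : ℝ), dist x y ≤ r) ∧
    (∀ y ∈ rectBdry g p q (n : ℝ), ∃ x ∈ Γ n, dist x y ≤ r)

/-! ### Miscellaneous notions -/

/-- Union of the bounded connected components of `P \ C`. -/
def boundedPartIn (P C : Set Pt) : Set Pt :=
  ⋃₀ {V : Set Pt | V ⊆ P \ C ∧ IsPreconnected V ∧ Bornology.IsBounded V}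

/-- `S` is uniformly asymptotic to `T` outside compact sets. -/
def AsymptoticTo (τ : ℝ) (S T : Set Pt) : Prop :=
  ∀ ε : ℝ, 0 < ε → ∃ K : Set Pt, IsCompact K ∧
    (∀ p ∈ S \ K, ∃ q ∈ T, pslDist τ p q < ε) ∧
    (∀ q ∈ T \ K, ∃ p ∈ S, pslDist τ p q < ε)

/-- `A` lies entirely on one side of the leaf `L`. -/
def OnOneSideOf (A L : Set Pt) : Prop :=
  ∃ C : Set Pt, IsPreconnected C ∧ C ⊆ pslSpace \ L ∧ A \ L ⊆ C

/-- A segment: a connected set with more than one point. -/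
def IsSeg (A : Set Pt) : Prop := IsConnected A ∧ A.Nontrivial

/-- An isometry of `E³(κ,τ)`. -/
def IsAmbIsometry (κ τ : ℝ) (F : Pt → Pt) : Prop :=
  ContDiff ℝ (⊤ : ℕ∞) F ∧ Set.BijOn F (spaceE κ) (spaceE κ) ∧
  ∀ p ∈ spaceE κ, ∀ v : Pt, quadE κ τ (F p) (fderiv ℝ F p v) = quadE κ τ p v

/-- Rotation by `π` about the vertical geodesic `{x} × ℝ` of `PSL~₂(ℝ,τ)`. -/
def IsVertRotation (τ : ℝ) (σ : Pt → Pt) (x : ℂ) : Prop :=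
  IsAmbIsometry (-1) τ σ ∧ (∀ p ∈ pslSpace, σ (σ p) = p) ∧
  {p ∈ pslSpace | σ p = p} = vert {x}

def zBand (a b : ℝ) : Set Pt := {p | a ≤ p.2 ∧ p.2 ≤ b}

def zBelow (b : ℝ) : Set Pt := {p | p.2 ≤ b}

/-- The closed `ε`-neighborhood of `G` in `H²` (region between the two equidistant
curves `G(−ε)` and `G(ε)`). -/
def hNbhd (G : Set ℂ) (ε : ℝ) : Set ℂ := {w ∈ hDisk | ∃ q ∈ G, hDist w q ≤ ε}

/-- Local convergence of a sequence of surfaces to a limit surface. -/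
def LocallyConverges (Sseq : ℕ → Set Pt) (S : Set Pt) : Prop :=
  (∀ p ∈ S, ∀ ε : ℝ, 0 < ε → ∀ᶠ n in atTop, ∃ q ∈ Sseq n, dist p q < ε) ∧
  (∀ K : Set Pt, IsCompact K → K ⊆ pslSpace → ∀ ε : ℝ, 0 < ε → ∀ᶠ n in atTop,
      ∀ q ∈ Sseq n ∩ K, ∃ p ∈ S, dist p q < ε)

/-- Convergence with multiplicity one: locally a single sheet. -/
def WithMultiplicityOne (Sseq : ℕ → Set Pt) (S : Set Pt) : Prop :=
  ∀ p ∈ S, ∃ W : Set Pt, IsOpen W ∧ p ∈ W ∧ ∀ᶠ n in atTop, IsPreconnected (Sseq n ∩ W)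
/-! ### The hyperboloid model and the Klein model -/

/-- The Lorentz form of signature `(1,2)`. -/
def lor (X Y : ℝ × ℂ) : ℝ := X.1 * Y.1 - (X.2.re * Y.2.re + X.2.im * Y.2.im)

/-- The upper sheet of the hyperboloid. -/
def upperSheet : Set (ℝ × ℂ) := {X | 0 < X.1 ∧ lor X X = 1}

/-- The isometry from the disk model to the hyperboloid model. -/
def toSheet (w : ℂ) : ℝ × ℂ :=
  ((4 + Complex.normSq w) / (4 - Complex.normSq w), (4 / (4 - Complex.normSq w) : ℝ) • w)

/-- The isometry from the hyperboloid model to the disk model. -/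
def ofSheet (X : ℝ × ℂ) : ℂ := (2 / (1 + X.1) : ℝ) • X.2

/-- The map from the disk model to the Klein model. -/
def klein (w : ℂ) : ℂ := (4 / (4 + Complex.normSq w) : ℝ) • w

/-- The inverse of the map from the disk model to the Klein model. -/
def kleinInv (k : ℂ) : ℂ := (2 / (1 + Real.sqrt (1 - Complex.normSq k)) : ℝ) • k

lemma lor_comm (X Y : ℝ × ℂ) : lor X Y = lor Y X := by
  unfold lor; ring

lemma lor_add_left (X Y Z : ℝ × ℂ) : lor (X + Y) Z = lor X Z + lor Y Z := by
  simp [lor]; ring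

lemma lor_smul_left (a : ℝ) (X Z : ℝ × ℂ) : lor (a • X) Z = a * lor X Z := by
  simp [lor]; ring

lemma lor_add_right (X Y Z : ℝ × ℂ) : lor X (Y + Z) = lor X Y + lor X Z := by
  simp [lor]; ring

lemma lor_smul_right (a : ℝ) (X Z : ℝ × ℂ) : lor X (a • Z) = a * lor X Z := by
  simp [lor]; ring

lemma eq_zero_of_lor_eq_zero {X W : ℝ × ℂ} (hX : X ∈ upperSheet) (hWX : lor W X = 0)
    (hWW : lor W W = 0) : W = 0 := by
  obtain ⟨t, x⟩ := X
  obtain ⟨s, w⟩ := W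
  obtain ⟨ht, hX⟩ := hX
  simp only [lor] at *
  have h1 : s ^ 2 * t ^ 2 ≤ s ^ 2 * (t ^ 2 - 1) := by
    have e1 : s * t = w.re * x.re + w.im * x.im := by linarith
    have e2 : s ^ 2 = w.re ^ 2 + w.im ^ 2 := by linarith
    have e3 : t ^ 2 - 1 = x.re ^ 2 + x.im ^ 2 := by linarith
    rw [← mul_pow, e1, e2, e3]
    nlinarith [sq_nonneg (w.re * x.im - w.im * x.re)]
  have hs : s = 0 := by nlinarith
  subst hs
  have hre : w.re = 0 := by nlinarith [sq_nonneg w.re, sq_nonneg w.im]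
  have him : w.im = 0 := by nlinarith [sq_nonneg w.re, sq_nonneg w.im]
  have hw : w = 0 := Complex.ext hre him
  simp [hw]

lemma one_le_lor {X Y : ℝ × ℂ} (hX : X ∈ upperSheet) (hY : Y ∈ upperSheet) : 1 ≤ lor X Y := by
  obtain ⟨t, x⟩ := X
  obtain ⟨s, y⟩ := Y
  obtain ⟨ht, hX⟩ := hX
  obtain ⟨hs, hY⟩ := hY
  simp only [lor] at *
  have h : (1 + (x.re * y.re + x.im * y.im)) ^ 2 ≤ (t * s) ^ 2 := by
    have e1 : t ^ 2 = 1 + x.re ^ 2 + x.im ^ 2 := by linarith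
    have e2 : s ^ 2 = 1 + y.re ^ 2 + y.im ^ 2 := by linarith
    rw [mul_pow, e1, e2]
    nlinarith [sq_nonneg (x.re * y.im - x.im * y.re), sq_nonneg (x.re - y.re),
      sq_nonneg (x.im - y.im)]
  have := (le_abs_self _).trans (abs_le_of_sq_le_sq h (by positivity))
  linarith

/-- Three points of the hyperboloid whose distances are those of three points of a line
are linearly dependent, with explicit coefficients. -/
lemma sheet_relation {X Y Z : ℝ × ℂ} (hX : X ∈ upperSheet) (hY : Y ∈ upperSheet)
    (hZ : Z ∈ upperSheet) {s t u : ℝ} (hXY : lor X Y = Real.cosh (s - t))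
    (hYZ : lor Y Z = Real.cosh (t - u)) (hZX : lor Z X = Real.cosh (u - s)) :
    Real.sinh (u - t) • X + Real.sinh (s - u) • Y + Real.sinh (t - s) • Z = 0 := by
  have key : ∀ a b c : ℝ, Real.sinh (c - b) + Real.sinh (a - c) * Real.cosh (a - b) +
      Real.sinh (b - a) * Real.cosh (c - a) = 0 := by
    intro a b c
    have h1 : c - b = (c - a) + (a - b) := by ring
    have h2 : a - c = -(c - a) := by ring
    have h3 : b - a = -(a - b) := by ring
    rw [h1, h2, h3, Real.sinh_add, Real.sinh_neg, Real.sinh_neg]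
    ring
  have hYX := lor_comm Y X
  have hZY := lor_comm Z Y
  have hXZ := lor_comm X Z
  have e1 : lor (Real.sinh (u - t) • X + Real.sinh (s - u) • Y + Real.sinh (t - s) • Z) X = 0 := by
    simp only [lor_add_left, lor_smul_left, hX.2, hYX, hXY, hZX, mul_one]
    exact key s t u
  have e2 : lor (Real.sinh (u - t) • X + Real.sinh (s - u) • Y + Real.sinh (t - s) • Z) Y = 0 := by
    simp only [lor_add_left, lor_smul_left, hY.2, hZY, hXY, hYZ, mul_one]
    linarith [key t u s]
  have e3 : lor (Real.sinh (u - t) • X + Real.sinh (s - u) • Y + Real.sinh (t - s) • Z) Z = 0 := by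
    simp only [lor_add_left, lor_smul_left, hZ.2, hXZ, hZX, hYZ, mul_one]
    linarith [key u s t]
  refine eq_zero_of_lor_eq_zero hX e1 ?_
  rw [lor_add_right, lor_add_right, lor_smul_right, lor_smul_right, lor_smul_right, e1, e2, e3]
  simp

/-- The Gram determinant of three points of the hyperboloid is nonnegative. -/
lemma gram_nonneg {X Y Z : ℝ × ℂ} (hX : X ∈ upperSheet) (hY : Y ∈ upperSheet)
    (hZ : Z ∈ upperSheet) :
    (lor X Y - lor X Z * lor Z Y) ^ 2 ≤ (lor X Z ^ 2 - 1) * (lor Z Y ^ 2 - 1) := by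
  have h : (lor X Z ^ 2 - lor X X * lor Z Z) * (lor Z Y ^ 2 - lor Z Z * lor Y Y) -
      (lor X Y * lor Z Z - lor X Z * lor Z Y) ^ 2 =
      lor Z Z * (X.1 * (Y.2.re * Z.2.im - Y.2.im * Z.2.re) - Y.1 * (X.2.re * Z.2.im - X.2.im * Z.2.re)
        + Z.1 * (X.2.re * Y.2.im - X.2.im * Y.2.re)) ^ 2 := by
    simp only [lor]; ring
  rw [hX.2, hY.2, hZ.2] at h
  nlinarith [sq_nonneg (X.1 * (Y.2.re * Z.2.im - Y.2.im * Z.2.re)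
    - Y.1 * (X.2.re * Z.2.im - X.2.im * Z.2.re) + Z.1 * (X.2.re * Y.2.im - X.2.im * Y.2.re))]

lemma normSq_klein_lt_one {w : ℂ} (hw : w ∈ hDisk) : Complex.normSq (klein w) < 1 := by
  have h0 := Complex.normSq_nonneg w
  have h : Complex.normSq w < 4 := hw
  have e : Complex.normSq (klein w) =
      (4 / (4 + Complex.normSq w)) ^ 2 * Complex.normSq w := by
    simp only [klein, Complex.real_smul, Complex.normSq_mul, Complex.normSq_ofReal]; ring
  rw [e, div_pow, div_mul_eq_mul_div, div_lt_one (by positivity)]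
  nlinarith [sq_pos_of_pos (sub_pos.2 h)]

lemma toSheet_mem {w : ℂ} (hw : w ∈ hDisk) : toSheet w ∈ upperSheet := by
  have h0 := Complex.normSq_nonneg w
  have h : 0 < 4 - Complex.normSq w := sub_pos.2 hw
  refine ⟨by simp only [toSheet]; positivity, ?_⟩
  have e : w.re * w.re + w.im * w.im = Complex.normSq w := (Complex.normSq_apply w).symm
  simp only [lor, toSheet, Complex.smul_re, Complex.smul_im, smul_eq_mul]
  field_simp
  linear_combination (-16) * e

lemma lor_toSheet {w v : ℂ} (hw : w ∈ hDisk) (hv : v ∈ hDisk) :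
    lor (toSheet w) (toSheet v) = 1 + 8 * Complex.normSq (w - v) /
      ((4 - Complex.normSq w) * (4 - Complex.normSq v)) := by
  have h1 : 4 - Complex.normSq w ≠ 0 := (sub_pos.2 hw).ne'
  have h2 : 4 - Complex.normSq v ≠ 0 := (sub_pos.2 hv).ne'
  simp only [lor, toSheet, Complex.smul_re, Complex.smul_im, smul_eq_mul]
  field_simp
  simp only [Complex.normSq_apply, Complex.sub_re, Complex.sub_im]
  ring

lemma ofSheet_mem {X : ℝ × ℂ} (hX : X ∈ upperSheet) : ofSheet X ∈ hDisk := by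
  obtain ⟨t, x⟩ := X
  obtain ⟨ht, hX⟩ := hX
  simp only [lor] at *
  have e : Complex.normSq x = t * t - 1 := by rw [Complex.normSq_apply]; linarith
  simp only [ofSheet, hDisk, mem_ofPred_eq, Complex.real_smul, Complex.normSq_mul,
    Complex.normSq_ofReal, e]
  rw [div_mul_div_comm, div_mul_eq_mul_div, div_lt_iff₀ (by positivity)]
  nlinarith

lemma toSheet_ofSheet {X : ℝ × ℂ} (hX : X ∈ upperSheet) : toSheet (ofSheet X) = X := by
  obtain ⟨t, x⟩ := X
  obtain ⟨ht, hX⟩ := hX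
  simp only [lor] at *
  have e : Complex.normSq x = t * t - 1 := by rw [Complex.normSq_apply]; linarith
  have e2 : Complex.normSq (ofSheet (t, x)) = 4 * (t - 1) / (1 + t) := by
    simp only [ofSheet, Complex.real_smul, Complex.normSq_mul, Complex.normSq_ofReal, e]
    field_simp
    ring
  have e3 : 4 - Complex.normSq (ofSheet (t, x)) = 8 / (1 + t) := by
    rw [e2]; field_simp; ring
  have e4 : 4 + Complex.normSq (ofSheet (t, x)) = 8 * t / (1 + t) := by
    rw [e2]; field_simp; ring
  simp only [toSheet, e3, e4]
  simp only [ofSheet, smul_smul]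
  refine Prod.ext ?_ ?_
  · simp only; field_simp
  · have : 4 / (8 / (1 + t)) * (2 / (1 + t)) = 1 := by field_simp; norm_num
    simp only [this, one_smul]

lemma ofSheet_toSheet {w : ℂ} (hw : w ∈ hDisk) : ofSheet (toSheet w) = w := by
  have h1 : 4 - Complex.normSq w ≠ 0 := (sub_pos.2 hw).ne'
  have : 2 / (1 + (4 + Complex.normSq w) / (4 - Complex.normSq w)) *
      (4 / (4 - Complex.normSq w)) = 1 := by
    have : 1 + (4 + Complex.normSq w) / (4 - Complex.normSq w) = 8 / (4 - Complex.normSq w) := by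
      field_simp; ring
    rw [this]; field_simp; norm_num
  simp only [ofSheet, toSheet, smul_smul, this, one_smul]

lemma toSheet_injOn : InjOn toSheet hDisk :=
  LeftInvOn.injOn (f₁' := ofSheet) fun _ hw => ofSheet_toSheet hw

lemma toSheet_snd {w : ℂ} (hw : w ∈ hDisk) : (toSheet w).2 = (toSheet w).1 • klein w := by
  have h0 := Complex.normSq_nonneg w
  have h1 : 4 - Complex.normSq w ≠ 0 := (sub_pos.2 hw).ne'
  simp only [toSheet, klein, smul_smul]
  congr 1
  field_simp

lemma kleinInv_klein {w : ℂ} (hw : w ∈ hDisk) : kleinInv (klein w) = w := by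
  have h0 := Complex.normSq_nonneg w
  have h : 0 < 4 - Complex.normSq w := sub_pos.2 hw
  have e : 1 - Complex.normSq (klein w) =
      ((4 - Complex.normSq w) / (4 + Complex.normSq w)) ^ 2 := by
    simp only [klein, Complex.real_smul, Complex.normSq_mul, Complex.normSq_ofReal]
    field_simp; ring
  rw [kleinInv, e, Real.sqrt_sq (by positivity), klein, smul_smul]
  have : 2 / (1 + (4 - Complex.normSq w) / (4 + Complex.normSq w)) *
      (4 / (4 + Complex.normSq w)) = 1 := by
    field_simp; ring
  rw [this, one_smul]

lemma kleinInv_mem {k : ℂ} (hk : Complex.normSq k < 1) : kleinInv k ∈ hDisk := by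
  have hs : 0 < Real.sqrt (1 - Complex.normSq k) := Real.sqrt_pos.2 (by linarith)
  have e := Real.sq_sqrt (sub_nonneg.2 hk.le)
  simp only [kleinInv, hDisk, mem_ofPred_eq, Complex.real_smul, Complex.normSq_mul,
    Complex.normSq_ofReal]
  rw [div_mul_div_comm, div_mul_eq_mul_div, div_lt_iff₀ (by positivity)]
  nlinarith

lemma klein_kleinInv {k : ℂ} (hk : Complex.normSq k < 1) : klein (kleinInv k) = k := by
  have hs : 0 < Real.sqrt (1 - Complex.normSq k) := Real.sqrt_pos.2 (by linarith)
  have e := Real.sq_sqrt (sub_nonneg.2 hk.le)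
  set s := Real.sqrt (1 - Complex.normSq k) with hsdef
  have ek : Complex.normSq k = 1 - s ^ 2 := by linarith
  have e2 : 4 + Complex.normSq (kleinInv k) = 8 / (1 + s) := by
    simp only [kleinInv, Complex.real_smul, Complex.normSq_mul, Complex.normSq_ofReal]
    rw [← hsdef, ek]
    field_simp; ring
  rw [klein, e2, kleinInv, ← hsdef, smul_smul]
  have : 4 / (8 / (1 + s)) * (2 / (1 + s)) = 1 := by field_simp; norm_num
  rw [this, one_smul]

lemma klein_injOn : InjOn klein hDisk :=
  LeftInvOn.injOn (f₁' := kleinInv) fun _ hw => kleinInv_klein hw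

lemma continuous_klein : Continuous klein := by
  unfold klein
  refine Continuous.smul (continuous_const.div (continuous_const.add Complex.continuous_normSq) ?_)
    continuous_id
  intro w
  exact (add_pos_of_pos_of_nonneg four_pos (Complex.normSq_nonneg w)).ne'

lemma continuous_kleinInv : Continuous kleinInv := by
  unfold kleinInv
  refine Continuous.smul (continuous_const.div (continuous_const.add
    (continuous_const.sub Complex.continuous_normSq).sqrt) ?_) continuous_id
  intro w
  exact (add_pos_of_pos_of_nonneg one_pos (Real.sqrt_nonneg _)).ne'

/-! ### Hyperbolic distance -/

lemma one_le_lor_toSheet {x y : ℂ} (hx : x ∈ hDisk) (hy : y ∈ hDisk) :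
    1 ≤ lor (toSheet x) (toSheet y) := one_le_lor (toSheet_mem hx) (toSheet_mem hy)

lemma hDist_eq_arcosh {x y : ℂ} (hx : x ∈ hDisk) (hy : y ∈ hDisk) :
    hDist x y = Real.arcosh (lor (toSheet x) (toSheet y)) := by
  rw [lor_toSheet hx hy]; rfl

lemma lor_eq_cosh {x y : ℂ} (hx : x ∈ hDisk) (hy : y ∈ hDisk) :
    lor (toSheet x) (toSheet y) = Real.cosh (hDist x y) := by
  rw [hDist_eq_arcosh hx hy, Real.cosh_arcosh (one_le_lor_toSheet hx hy)]

lemma hDist_nonneg {x y : ℂ} (hx : x ∈ hDisk) (hy : y ∈ hDisk) : 0 ≤ hDist x y := by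
  rw [hDist_eq_arcosh hx hy]
  exact Real.arcosh_nonneg (one_le_lor_toSheet hx hy)

lemma hDist_comm {x y : ℂ} (hx : x ∈ hDisk) (hy : y ∈ hDisk) : hDist x y = hDist y x := by
  rw [hDist_eq_arcosh hx hy, hDist_eq_arcosh hy hx, lor_comm]

lemma lor_sq_sub_one {x y : ℂ} (hx : x ∈ hDisk) (hy : y ∈ hDisk) :
    lor (toSheet x) (toSheet y) ^ 2 - 1 = Real.sinh (hDist x y) ^ 2 := by
  rw [lor_eq_cosh hx hy, Real.cosh_sq]; ring

lemma hDist_triangle {x y z : ℂ} (hx : x ∈ hDisk) (hy : y ∈ hDisk) (hz : z ∈ hDisk) :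
    hDist x y ≤ hDist x z + hDist z y := by
  have h := gram_nonneg (toSheet_mem hx) (toSheet_mem hy) (toSheet_mem hz)
  rw [lor_sq_sub_one hx hz, lor_sq_sub_one hz hy, lor_eq_cosh hx hy, lor_eq_cosh hx hz,
    lor_eq_cosh hz hy, ← mul_pow] at h
  have hxz := hDist_nonneg hx hz
  have hzy := hDist_nonneg hz hy
  have := (le_abs_self _).trans (abs_le_of_sq_le_sq h
    (mul_nonneg (Real.sinh_nonneg_iff.2 hxz) (Real.sinh_nonneg_iff.2 hzy)))
  have h2 : Real.cosh (hDist x y) ≤ Real.cosh (hDist x z + hDist z y) := by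
    rw [Real.cosh_add]; linarith
  rw [Real.cosh_le_cosh, abs_of_nonneg (hDist_nonneg hx hy), abs_of_nonneg (by positivity)] at h2
  exact h2

lemma eq_of_hDist_eq_zero {x y : ℂ} (hx : x ∈ hDisk) (hy : y ∈ hDisk) (h : hDist x y = 0) :
    x = y := by
  have h1 : lor (toSheet x) (toSheet y) = 1 := by rw [lor_eq_cosh hx hy, h, Real.cosh_zero]
  have h2 := lor_comm (toSheet y) (toSheet x)
  refine toSheet_injOn hx hy (sub_eq_zero.1 ?_)
  have e1 : lor (toSheet x - toSheet y) (toSheet x) = 0 := by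
    rw [sub_eq_add_neg, ← neg_one_smul ℝ, lor_add_left, lor_smul_left, h2, h1,
      (toSheet_mem hx).2]; ring
  have e2 : lor (toSheet x - toSheet y) (toSheet y) = 0 := by
    rw [sub_eq_add_neg, ← neg_one_smul ℝ, lor_add_left, lor_smul_left, h1,
      (toSheet_mem hy).2]; ring
  refine eq_zero_of_lor_eq_zero (toSheet_mem hx) e1 ?_
  nth_rw 2 [sub_eq_add_neg]
  rw [← neg_one_smul ℝ, lor_add_right, lor_smul_right, e1, e2]; ring

lemma hDist_self {x : ℂ} (hx : x ∈ hDisk) : hDist x x = 0 := by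
  rw [hDist_eq_arcosh hx hx, (toSheet_mem hx).2, Real.arcosh_zero]

lemma hDist_pos {x y : ℂ} (hx : x ∈ hDisk) (hy : y ∈ hDisk) (h : x ≠ y) : 0 < hDist x y :=
  (hDist_nonneg hx hy).lt_of_ne fun h0 => h (eq_of_hDist_eq_zero hx hy h0.symm)

lemma toSheet_of_hDist_add {x y z : ℂ} (hx : x ∈ hDisk) (hy : y ∈ hDisk) (hz : z ∈ hDisk)
    (h : hDist x z + hDist z y = hDist x y) :
    Real.sinh (hDist x y) • toSheet z =
      Real.sinh (hDist z y) • toSheet x + Real.sinh (hDist x z) • toSheet y := by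
  have := sheet_relation (toSheet_mem hx) (toSheet_mem hz) (toSheet_mem hy)
    (s := 0) (t := hDist x z) (u := hDist x y)
    (by rw [lor_eq_cosh hx hz, zero_sub, Real.cosh_neg])
    (by rw [lor_eq_cosh hz hy, ← h, ← Real.cosh_neg]; congr 1; ring)
    (by rw [lor_comm, lor_eq_cosh hx hy, sub_zero])
  rw [← h, add_sub_cancel_left, zero_sub, sub_zero, Real.sinh_neg, h] at this
  rw [← sub_eq_zero, ← neg_eq_zero, ← this]
  module

/-- A point of a hyperbolic segment is determined by its distances to the endpoints. -/
lemma eq_of_hDist_add {x y z w : ℂ} (hx : x ∈ hDisk) (hy : y ∈ hDisk) (hz : z ∈ hDisk)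
    (hw : w ∈ hDisk) (h : hDist x z + hDist z y = hDist x y) (h1 : hDist x w = hDist x z)
    (h2 : hDist w y = hDist z y) : w = z := by
  rcases eq_or_ne x y with rfl | hxy
  · rw [hDist_self hx] at h
    have hxz := hDist_nonneg hx hz
    have hzx := hDist_nonneg hz hx
    have h0 : hDist x z = 0 := by linarith
    rw [← eq_of_hDist_eq_zero hx hw (h1.trans h0), ← eq_of_hDist_eq_zero hx hz h0]
  · have e1 := toSheet_of_hDist_add hx hy hz h
    have e2 := toSheet_of_hDist_add hx hy hw (by rw [h1, h2, h])
    rw [h1, h2, ← e1] at e2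
    have hs : Real.sinh (hDist x y) ≠ 0 := (Real.sinh_pos_iff.2 (hDist_pos hx hy hxy)).ne'
    exact toSheet_injOn hw hz (smul_right_injective _ hs e2)

/-- Affine combinations in the Klein model are linear combinations in the hyperboloid model. -/
lemma toSheet_of_klein_combo {x y z : ℂ} (hx : x ∈ hDisk) (hy : y ∈ hDisk) (hz : z ∈ hDisk)
    {a b : ℝ} (hab : a + b = 1) (h : a • klein x + b • klein y = klein z) :
    toSheet z = (a * (toSheet z).1 / (toSheet x).1) • toSheet x +
      (b * (toSheet z).1 / (toSheet y).1) • toSheet y := by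
  have px := (toSheet_mem hx).1
  have py := (toSheet_mem hy).1
  have pz := (toSheet_mem hz).1
  refine Prod.ext ?_ ?_
  · simp only [Prod.fst_add, Prod.smul_fst, smul_eq_mul]
    field_simp
    rw [hab]
  · simp only [Prod.snd_add, Prod.smul_snd]
    rw [toSheet_snd hx, toSheet_snd hy, smul_smul, smul_smul, div_mul_cancel₀ _ px.ne',
      div_mul_cancel₀ _ py.ne', toSheet_snd hz, ← h]
    module

lemma klein_combo_of_toSheet {x y z : ℂ} (hx : x ∈ hDisk) (hy : y ∈ hDisk) (hz : z ∈ hDisk)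
    {a b c : ℝ} (hc : 0 < c) (h : c • toSheet z = a • toSheet x + b • toSheet y) :
    (a * (toSheet x).1 / (c * (toSheet z).1)) + (b * (toSheet y).1 / (c * (toSheet z).1)) = 1 ∧
    (a * (toSheet x).1 / (c * (toSheet z).1)) • klein x +
      (b * (toSheet y).1 / (c * (toSheet z).1)) • klein y = klein z := by
  have pz := (toSheet_mem hz).1
  have h1 : c * (toSheet z).1 = a * (toSheet x).1 + b * (toSheet y).1 := congrArg Prod.fst h
  have h2 : c • (toSheet z).2 = a • (toSheet x).2 + b • (toSheet y).2 := congrArg Prod.snd h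
  have hcz : c * (toSheet z).1 ≠ 0 := (mul_pos hc pz).ne'
  refine ⟨by rw [← add_div, ← h1, div_self hcz], ?_⟩
  rw [toSheet_snd hx, toSheet_snd hy, toSheet_snd hz, smul_smul, smul_smul, smul_smul] at h2
  refine smul_right_injective _ hcz ?_
  simp only [smul_add, smul_smul, mul_div_cancel₀ _ hcz]
  exact h2.symm

/-- Equality in the triangle inequality characterizes the points of Klein segments. -/
lemma hDist_add_iff {x y z : ℂ} (hx : x ∈ hDisk) (hy : y ∈ hDisk) (hz : z ∈ hDisk) :
    hDist x z + hDist z y = hDist x y ↔ klein z ∈ segment ℝ (klein x) (klein y) := by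
  have hxz := hDist_nonneg hx hz
  have hzy := hDist_nonneg hz hy
  constructor
  · intro h
    rcases eq_or_ne x y with rfl | hxy
    · rw [hDist_self hx] at h
      rw [eq_of_hDist_eq_zero hx hz (by linarith)]
      exact left_mem_segment _ _ _
    · have hs := Real.sinh_pos_iff.2 (hDist_pos hx hy hxy)
      obtain ⟨h1, h2⟩ := klein_combo_of_toSheet hx hy hz hs (toSheet_of_hDist_add hx hy hz h)
      have px := (toSheet_mem hx).1
      have py := (toSheet_mem hy).1
      have pz := (toSheet_mem hz).1
      have s1 := Real.sinh_nonneg_iff.2 hxz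
      have s2 := Real.sinh_nonneg_iff.2 hzy
      exact ⟨_, _, by positivity, by positivity, h1, h2⟩
  · rintro ⟨a, b, ha, hb, hab, h⟩
    have px := (toSheet_mem hx).1
    have py := (toSheet_mem hy).1
    have pz := (toSheet_mem hz).1
    have e := toSheet_of_klein_combo hx hy hz hab h
    have hα : 0 ≤ a * (toSheet z).1 / (toSheet x).1 := by positivity
    have hβ : 0 ≤ b * (toSheet z).1 / (toSheet y).1 := by positivity
    set α := a * (toSheet z).1 / (toSheet x).1
    set β := b * (toSheet z).1 / (toSheet y).1
    set c := lor (toSheet x) (toSheet y) with hc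
    have hc1 : 1 ≤ c := one_le_lor_toSheet hx hy
    have hyx : lor (toSheet y) (toSheet x) = c := lor_comm _ _
    have e1 : lor (toSheet x) (toSheet z) = α + β * c := by
      rw [e, lor_add_right, lor_smul_right, lor_smul_right, (toSheet_mem hx).2, ← hc]; ring
    have e2 : lor (toSheet z) (toSheet y) = α * c + β := by
      rw [e, lor_add_left, lor_smul_left, lor_smul_left, (toSheet_mem hy).2, ← hc]; ring
    have e3 : α ^ 2 + β ^ 2 + 2 * α * β * c = 1 := by
      have h1 := (toSheet_mem hz).2
      nth_rw 1 [e] at h1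
      rw [lor_add_left, lor_smul_left, lor_smul_left, e1, lor_comm, e2] at h1
      linarith
    have hxy := hDist_nonneg hx hy
    rw [lor_eq_cosh hx hz] at e1
    rw [lor_eq_cosh hz hy] at e2
    have s1 : Real.sinh (hDist x z) = β * Real.sinh (hDist x y) := by
      rw [← sq_eq_sq₀ (Real.sinh_nonneg_iff.2 hxz)
        (mul_nonneg hβ (Real.sinh_nonneg_iff.2 hxy)), mul_pow, ← lor_sq_sub_one hx hy,
        Real.sinh_sq, e1, ← hc]
      linear_combination e3
    have s2 : Real.sinh (hDist z y) = α * Real.sinh (hDist x y) := by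
      rw [← sq_eq_sq₀ (Real.sinh_nonneg_iff.2 hzy)
        (mul_nonneg hα (Real.sinh_nonneg_iff.2 hxy)), mul_pow, ← lor_sq_sub_one hx hy,
        Real.sinh_sq, e2, ← hc]
      linear_combination e3
    have h2 : Real.cosh (hDist x z + hDist z y) = Real.cosh (hDist x y) := by
      have h3 := lor_sq_sub_one hx hy
      rw [Real.cosh_add, e1, e2, s1, s2, ← lor_eq_cosh hx hy, ← hc]
      rw [← hc] at h3
      linear_combination (-(α * β)) * h3 + c * e3
    exact Real.cosh_injOn (by simpa using add_nonneg hxz hzy) (by simpa using hxy) h2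

/-! ### Geodesics -/

/-- Twice the signed area of a triangle. -/
def signedArea (a b c : ℂ) : ℝ := (b.re - a.re) * (c.im - a.im) - (b.im - a.im) * (c.re - a.re)

lemma geodesic_relation {γ : ℝ → ℂ} (hγ : ∀ t, γ t ∈ hDisk)
    (hiso : ∀ s t, hDist (γ s) (γ t) = |s - t|) (s t u : ℝ) :
    Real.sinh (u - t) • toSheet (γ s) + Real.sinh (s - u) • toSheet (γ t) +
      Real.sinh (t - s) • toSheet (γ u) = 0 := by
  have h : ∀ a b, lor (toSheet (γ a)) (toSheet (γ b)) = Real.cosh (a - b) := fun a b => by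
    rw [lor_eq_cosh (hγ a) (hγ b), hiso, Real.cosh_abs]
  exact sheet_relation (toSheet_mem (hγ s)) (toSheet_mem (hγ t)) (toSheet_mem (hγ u))
    (h _ _) (h _ _) (h _ _)

lemma geodesic_injective {γ : ℝ → ℂ} (hγ : ∀ t, γ t ∈ hDisk)
    (hiso : ∀ s t, hDist (γ s) (γ t) = |s - t|) : Function.Injective γ := by
  intro s t h
  have := hiso s t
  rw [h, hDist_self (hγ t)] at this
  exact sub_eq_zero.1 (abs_eq_zero.1 this.symm)

lemma geodesic_combo {γ : ℝ → ℂ} (hγ : ∀ t, γ t ∈ hDisk)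
    (hiso : ∀ s t, hDist (γ s) (γ t) = |s - t|) {s t : ℝ} (hst : s < t) (u : ℝ) :
    ∃ a b : ℝ, a + b = 1 ∧ a • klein (γ s) + b • klein (γ t) = klein (γ u) := by
  have h := geodesic_relation hγ hiso s t u
  have h' : Real.sinh (t - s) • toSheet (γ u) = (-Real.sinh (u - t)) • toSheet (γ s) +
      (-Real.sinh (s - u)) • toSheet (γ t) := by
    rw [← sub_eq_zero, ← h]; module
  exact ⟨_, _, klein_combo_of_toSheet (hγ s) (hγ t) (hγ u)
    (Real.sinh_pos_iff.2 (sub_pos.2 hst)) h'⟩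

/-- A geodesic contains every point of the disk lying on the Klein line through two of
its points. -/
lemma mem_range_geodesic {γ : ℝ → ℂ} (hγ : ∀ t, γ t ∈ hDisk)
    (hiso : ∀ s t, hDist (γ s) (γ t) = |s - t|) {s t : ℝ} (hst : s ≠ t) {u : ℂ} (hu : u ∈ hDisk)
    {a b : ℝ} (hab : a + b = 1) (h : a • klein (γ s) + b • klein (γ t) = klein u) :
    u ∈ range γ := by
  have hcosh : ∀ a b, lor (toSheet (γ a)) (toSheet (γ b)) = Real.cosh (a - b) := fun a b => by
    rw [lor_eq_cosh (hγ a) (hγ b), hiso, Real.cosh_abs]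
  have e := toSheet_of_klein_combo (hγ s) (hγ t) hu hab h
  set α := a * (toSheet u).1 / (toSheet (γ s)).1
  set β := b * (toSheet u).1 / (toSheet (γ t)).1
  have e1 : lor (toSheet (γ s)) (toSheet u) = α + β * Real.cosh (t - s) := by
    rw [e, lor_add_right, lor_smul_right, lor_smul_right, hcosh, hcosh, sub_self, Real.cosh_zero,
      ← Real.cosh_neg (s - t), neg_sub, mul_one]
  have e2 : lor (toSheet (γ t)) (toSheet u) = α * Real.cosh (t - s) + β := by
    rw [e, lor_add_right, lor_smul_right, lor_smul_right, hcosh, hcosh, sub_self, Real.cosh_zero,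
      mul_one]
  have e3 : α ^ 2 + β ^ 2 + 2 * α * β * Real.cosh (t - s) = 1 := by
    have h1 := (toSheet_mem hu).2
    nth_rw 1 [e] at h1
    rw [lor_add_left, lor_smul_left, lor_smul_left, e1, e2] at h1
    linarith
  have hpos := one_le_lor_toSheet (hγ s) hu
  rw [e1] at hpos
  obtain ⟨v, hv⟩ := Real.sinh_surjective (β * Real.sinh (t - s))
  have hcv : Real.cosh v = α + β * Real.cosh (t - s) := by
    rw [← sq_eq_sq₀ (Real.cosh_pos v).le (by linarith), Real.cosh_sq, hv]
    linear_combination -e3 - β ^ 2 * Real.cosh_sq_sub_sinh_sq (t - s)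
  refine ⟨s + v, toSheet_injOn (hγ _) hu ?_⟩
  have hne : Real.sinh (t - s) ≠ 0 := fun h0 => hst (sub_eq_zero.1 (Real.sinh_eq_zero.1 h0)).symm
  have hrel := geodesic_relation hγ hiso s t (s + v)
  have h1 : Real.sinh (s + v - t) = -(Real.sinh (t - s) * α) := by
    have : s + v - t = v - (t - s) := by ring
    rw [this, Real.sinh_sub, hv, hcv]; ring
  have h2 : Real.sinh (s - (s + v)) = -(Real.sinh (t - s) * β) := by
    rw [sub_add_cancel_left, Real.sinh_neg, hv]; ring
  rw [h1, h2] at hrel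
  refine smul_right_injective _ hne ?_
  simp only
  rw [e, ← sub_eq_zero, ← hrel]
  module

/-- Any two distinct points of the disk are joined by a geodesic. -/
lemma exists_geodesic {p q : ℂ} (hp : p ∈ hDisk) (hq : q ∈ hDisk) (hpq : p ≠ q) :
    ∃ γ : ℝ → ℂ, (∀ t, γ t ∈ hDisk) ∧ (∀ s t, hDist (γ s) (γ t) = |s - t|) ∧
      γ 0 = p ∧ γ (hDist p q) = q := by
  set d := hDist p q with hd
  have hs : Real.sinh d ≠ 0 := (Real.sinh_pos_iff.2 (hDist_pos hp hq hpq)).ne'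
  set X := toSheet p with hX
  set Y := toSheet q with hY
  have hXX : lor X X = 1 := (toSheet_mem hp).2
  have hYY : lor Y Y = 1 := (toSheet_mem hq).2
  have hXY : lor X Y = Real.cosh d := lor_eq_cosh hp hq
  have hYX : lor Y X = Real.cosh d := by rw [lor_comm, hXY]
  set V : ℝ × ℂ := (Real.sinh d)⁻¹ • (Y + (-Real.cosh d) • X) with hV
  have hVX : lor V X = 0 := by
    simp only [hV, lor_add_left, lor_smul_left, hYX, hXX]; ring
  have hVV : lor V V = -1 := by
    simp only [hV, lor_add_left, lor_smul_left, lor_add_right, lor_smul_right, hYX, hXX, hXY, hYY]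
    field_simp
    linear_combination -Real.cosh_sq_sub_sinh_sq d
  have hXV : lor X V = 0 := by rw [lor_comm, hVX]
  set Γ : ℝ → ℝ × ℂ := fun t => Real.cosh t • X + Real.sinh t • V with hΓ
  have hlor : ∀ s t, lor (Γ s) (Γ t) = Real.cosh (s - t) := fun s t => by
    simp only [hΓ, lor_add_left, lor_smul_left, lor_add_right, lor_smul_right, hXX, hVX, hXV, hVV,
      Real.cosh_sub]
    ring
  have hVbound : V.1 ^ 2 < X.1 ^ 2 := by
    simp only [lor] at hXX hVV hVX
    have e1 : V.1 * X.1 = V.2.re * X.2.re + V.2.im * X.2.im := by linarith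
    have e2 : V.2.re ^ 2 + V.2.im ^ 2 = V.1 ^ 2 + 1 := by linarith
    have e3 : X.2.re ^ 2 + X.2.im ^ 2 = X.1 ^ 2 - 1 := by linarith
    have e4 : (V.1 * X.1) ^ 2 ≤ (V.1 ^ 2 + 1) * (X.1 ^ 2 - 1) := by
      rw [← e2, ← e3, e1]
      nlinarith [sq_nonneg (V.2.re * X.2.im - V.2.im * X.2.re)]
    nlinarith
  have hXpos : 0 < X.1 := (toSheet_mem hp).1
  have hmem : ∀ t, Γ t ∈ upperSheet := fun t => by
    refine ⟨?_, by rw [hlor, sub_self, Real.cosh_zero]⟩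
    have h1 : |Real.sinh t * V.1| < Real.cosh t * X.1 := by
      rw [← abs_of_pos (mul_pos (Real.cosh_pos t) hXpos), ← sq_lt_sq, mul_pow, mul_pow]
      have := Real.cosh_sq t
      nlinarith [sq_nonneg (Real.sinh t), sq_nonneg V.1]
    have := neg_lt_of_abs_lt h1
    simp only [hΓ, Prod.fst_add, Prod.smul_fst, smul_eq_mul]
    linarith
  have hγ : ∀ t, ofSheet (Γ t) ∈ hDisk := fun t => ofSheet_mem (hmem t)
  refine ⟨fun t => ofSheet (Γ t), hγ, fun s t => ?_, ?_, ?_⟩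
  · rw [hDist_eq_arcosh (hγ s) (hγ t), toSheet_ofSheet (hmem s), toSheet_ofSheet (hmem t), hlor,
      ← Real.cosh_abs, Real.arcosh_cosh (abs_nonneg _)]
  · have : Γ 0 = X := by simp [hΓ]
    simp only [this, hX, ofSheet_toSheet hp]
  · have : Γ d = Y := by
      simp only [hΓ, hV, smul_smul, mul_inv_cancel₀ hs]
      module
    simp only [this, hY, ofSheet_toSheet hq]

/-- A geodesic arc is a segment of the Klein model. -/
lemma IsGeodesicArc.eq_segment {A : Set ℂ} {p q : ℂ} (h : IsGeodesicArc A p q) :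
    p ∈ hDisk ∧ q ∈ hDisk ∧ p ≠ q ∧
      A = {x | x ∈ hDisk ∧ klein x ∈ openSegment ℝ (klein p) (klein q)} := by
  obtain ⟨γ, hγ, hiso, L, hL, rfl, rfl, rfl⟩ := h
  have hne : ∀ {s t}, s ≠ t → klein (γ s) ≠ klein (γ t) := fun hst h =>
    hst (geodesic_injective hγ hiso (klein_injOn (hγ _) (hγ _) h))
  refine ⟨hγ 0, hγ L, fun h => hL.ne (geodesic_injective hγ hiso h), Set.ext fun x => ?_⟩
  constructor
  · rintro ⟨t, ⟨h0, h1⟩, rfl⟩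
    refine ⟨hγ t, mem_openSegment_of_ne_left_right (hne h0.ne) (hne h1.ne') ?_⟩
    rw [← hDist_add_iff (hγ 0) (hγ L) (hγ t), hiso, hiso, hiso, zero_sub, zero_sub, abs_neg, abs_neg,
      abs_of_pos h0, abs_of_pos hL, abs_of_neg (by linarith)]
    ring
  · rintro ⟨hx, hxs⟩
    have hadd := (hDist_add_iff (hγ 0) (hγ L) hx).2 (openSegment_subset_segment _ _ _ hxs)
    have hL' : hDist (γ 0) (γ L) = L := by rw [hiso, zero_sub, abs_neg, abs_of_pos hL]
    have hKne := hne hL.ne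
    have h0 : 0 < hDist (γ 0) x := hDist_pos (hγ 0) hx <| by
      rintro rfl
      exact hKne (left_mem_openSegment_iff.1 hxs)
    have h1 : 0 < hDist x (γ L) := hDist_pos hx (hγ L) <| by
      rintro rfl
      exact hKne (right_mem_openSegment_iff.1 hxs)
    refine ⟨hDist (γ 0) x, ⟨h0, by linarith⟩, ?_⟩
    refine eq_of_hDist_add (hγ 0) (hγ L) hx (hγ _) hadd ?_ ?_
    · rw [hiso, zero_sub, abs_neg, abs_of_pos h0]
    · rw [hiso, abs_of_neg (by linarith)]; linarith

lemma exists_isGeodesicArc {p q : ℂ} (hp : p ∈ hDisk) (hq : q ∈ hDisk) (hpq : p ≠ q) :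
    ∃ A, IsGeodesicArc A p q := by
  obtain ⟨γ, hγ, hiso, h0, h1⟩ := exists_geodesic hp hq hpq
  exact ⟨_, γ, hγ, hiso, _, hDist_pos hp hq hpq, h0, h1, rfl⟩

lemma IsCompleteGeodesic.subset_hDisk {G : Set ℂ} (hG : IsCompleteGeodesic G) : G ⊆ hDisk := by
  obtain ⟨γ, hγ, -, rfl⟩ := hG
  exact range_subset_iff.2 hγ

lemma IsCompleteGeodesic.mem_of_combo {G : Set ℂ} (hG : IsCompleteGeodesic G) {x y u : ℂ}
    (hx : x ∈ G) (hy : y ∈ G) (hxy : x ≠ y) (hu : u ∈ hDisk) {a b : ℝ} (hab : a + b = 1)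
    (h : a • klein x + b • klein y = klein u) : u ∈ G := by
  obtain ⟨γ, hγ, hiso, rfl⟩ := hG
  obtain ⟨s, rfl⟩ := hx
  obtain ⟨t, rfl⟩ := hy
  exact mem_range_geodesic hγ hiso (fun h => hxy (congrArg γ h)) hu hab h

/-- A complete geodesic containing a geodesic arc contains its endpoints. -/
lemma IsCompleteGeodesic.endpoints_mem {G A : Set ℂ} (hG : IsCompleteGeodesic G) {p q : ℂ}
    (hA : IsGeodesicArc A p q) (hAG : A ⊆ G) : p ∈ G ∧ q ∈ G := by
  obtain ⟨γ, hγ, hiso, L, hL, rfl, rfl, rfl⟩ := hA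
  have h1 : γ (L / 3) ∈ G := hAG ⟨_, ⟨by linarith, by linarith⟩, rfl⟩
  have h2 : γ (2 * L / 3) ∈ G := hAG ⟨_, ⟨by linarith, by linarith⟩, rfl⟩
  have hlt : L / 3 < 2 * L / 3 := by linarith
  have key : ∀ t, γ t ∈ G := fun t => by
    obtain ⟨a, b, hab, h⟩ := geodesic_combo hγ hiso hlt t
    exact hG.mem_of_combo h1 h2 (fun h => hlt.ne (geodesic_injective hγ hiso h)) (hγ t) hab h
  exact ⟨key 0, key L⟩

/-- Strict triangle inequality for a broken line leaving a geodesic. -/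
lemma IsCompleteGeodesic.hDist_lt {G : Set ℂ} (hG : IsCompleteGeodesic G) {x y z : ℂ}
    (hx : x ∈ G) (hy : y ∈ G) (hxy : x ≠ y) (hz : z ∈ hDisk) (hzG : z ∉ G) :
    hDist x z < hDist x y + hDist y z := by
  have hxD := hG.subset_hDisk hx
  have hyD := hG.subset_hDisk hy
  refine (hDist_triangle hxD hz hyD).lt_of_ne fun h => hzG ?_
  obtain ⟨a, b, -, -, hab, hc⟩ := (hDist_add_iff hxD hz hyD).1 h.symm
  have hb : b ≠ 0 := by
    rintro rfl
    rw [add_zero] at hab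
    rw [hab, one_smul, zero_smul, add_zero] at hc
    exact hxy (klein_injOn hxD hyD hc)
  refine hG.mem_of_combo hx hy hxy hz (a := -(a / b)) (b := 1 / b) ?_ ?_
  · field_simp; linarith
  · rw [← hc, smul_add, smul_smul, smul_smul, one_div, inv_mul_cancel₀ hb, one_smul, ← add_assoc,
      ← add_smul]
    have : -(a / b) + b⁻¹ * a = 0 := by ring
    rw [this, zero_smul, zero_add]

lemma hDist_broken_lt {G G' : Set ℂ} (hG : IsCompleteGeodesic G) (hG' : IsCompleteGeodesic G')
    (hd : Disjoint G G') {x y x' y' : ℂ} (hx : x ∈ G) (hy : y ∈ G) (hx' : x' ∈ G')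
    (hy' : y' ∈ G') (hne : x ≠ y ∨ x' ≠ y') :
    hDist x x' < hDist x y + hDist y y' + hDist y' x' := by
  have hxD := hG.subset_hDisk hx
  have hyD := hG.subset_hDisk hy
  have hxD' := hG'.subset_hDisk hx'
  have hyD' := hG'.subset_hDisk hy'
  rcases hne with h | h
  · have h1 := hG.hDist_lt hx hy h hyD' (disjoint_right.1 hd hy')
    have h2 := hDist_triangle hxD hxD' hyD'
    linarith
  · have h1 := hG'.hDist_lt hx' hy' h hyD (disjoint_left.1 hd hy)
    have h2 := hDist_triangle hxD hxD' hyD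
    rw [hDist_comm hxD' hyD, hDist_comm hxD' hyD', hDist_comm hyD' hyD] at h1
    linarith

lemma hDist_broken_le {x y x' y' : ℂ} (hx : x ∈ hDisk) (hy : y ∈ hDisk) (hx' : x' ∈ hDisk)
    (hy' : y' ∈ hDisk) : hDist x x' ≤ hDist x y + hDist y y' + hDist y' x' := by
  have h1 := hDist_triangle hx hx' hy'
  have h2 := hDist_triangle hx hy' hy
  linarith

/-! ### Plane geometry in the Klein model -/

lemma signedArea_combo (a b c d : ℂ) {s t : ℝ} (hst : s + t = 1) :
    signedArea a b (s • c + t • d) = s * signedArea a b c + t * signedArea a b d := by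
  obtain rfl : s = 1 - t := by linarith
  simp [signedArea]; ring

lemma exists_combo_of_signedArea_eq_zero {a b c : ℂ} (hab : a ≠ b) (h : signedArea a b c = 0) :
    ∃ s t : ℝ, s + t = 1 ∧ s • a + t • b = c := by
  have hn : 0 < (b.re - a.re) ^ 2 + (b.im - a.im) ^ 2 := by
    by_contra! hle
    have h1 : b.re - a.re = 0 := by nlinarith [sq_nonneg (b.re - a.re), sq_nonneg (b.im - a.im)]
    have h2 : b.im - a.im = 0 := by nlinarith [sq_nonneg (b.re - a.re), sq_nonneg (b.im - a.im)]
    exact hab (Complex.ext (by linarith) (by linarith))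
  simp only [signedArea] at h
  set t := ((b.re - a.re) * (c.re - a.re) + (b.im - a.im) * (c.im - a.im)) /
    ((b.re - a.re) ^ 2 + (b.im - a.im) ^ 2) with ht
  have ht' : t * ((b.re - a.re) ^ 2 + (b.im - a.im) ^ 2) =
    (b.re - a.re) * (c.re - a.re) + (b.im - a.im) * (c.im - a.im) := div_mul_cancel₀ _ hn.ne'
  refine ⟨1 - t, t, by ring, ?_⟩
  apply Complex.ext
  · simp only [Complex.add_re, Complex.smul_re, smul_eq_mul]
    refine mul_left_cancel₀ hn.ne' ?_
    linear_combination (b.re - a.re) * ht' + (b.im - a.im) * h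
  · simp only [Complex.add_im, Complex.smul_im, smul_eq_mul]
    refine mul_left_cancel₀ hn.ne' ?_
    linear_combination (b.im - a.im) * ht' - (b.re - a.re) * h

lemma setOf_normSq_lt_one : {k : ℂ | Complex.normSq k < 1} = Metric.ball 0 1 := by
  ext k
  rw [mem_ofPred_eq, mem_ball_zero_iff, Complex.normSq_eq_norm_sq, sq_lt_one_iff₀ (norm_nonneg _)]

lemma convex_normSq_lt_one : Convex ℝ {k : ℂ | Complex.normSq k < 1} := by
  rw [setOf_normSq_lt_one]
  exact convex_ball _ _

/-- Of two disjoint geodesics, each lies on one side of the other. -/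
lemma signedArea_mul_pos {G G' : Set ℂ} (hG : IsCompleteGeodesic G) (hG' : IsCompleteGeodesic G')
    (hd : Disjoint G G') {x y u v : ℂ} (hx : x ∈ G) (hy : y ∈ G) (hxy : x ≠ y) (hu : u ∈ G')
    (hv : v ∈ G') :
    0 < signedArea (klein x) (klein y) (klein u) * signedArea (klein x) (klein y) (klein v) := by
  have hK : klein x ≠ klein y := fun h =>
    hxy (klein_injOn (hG.subset_hDisk hx) (hG.subset_hDisk hy) h)
  have hmem : ∀ w ∈ hDisk, signedArea (klein x) (klein y) (klein w) = 0 → w ∈ G := by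
    intro w hw h
    obtain ⟨s, t, hst, h⟩ := exists_combo_of_signedArea_eq_zero hK h
    exact hG.mem_of_combo hx hy hxy hw hst h
  have huD := hG'.subset_hDisk hu
  have hvD := hG'.subset_hDisk hv
  by_contra! hle
  set A := signedArea (klein x) (klein y) (klein u) with hA
  set B := signedArea (klein x) (klein y) (klein v) with hB
  have hA0 : A ≠ 0 := fun h => disjoint_right.1 hd hu (hmem u huD h)
  have hB0 : B ≠ 0 := fun h => disjoint_right.1 hd hv (hmem v hvD h)
  have hlt : A * B < 0 := hle.lt_of_ne (mul_ne_zero hA0 hB0)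
  have hAB : B - A ≠ 0 := fun h => by
    rw [sub_eq_zero.1 h] at hlt
    nlinarith [mul_self_nonneg A]
  have huv : u ≠ v := by
    rintro rfl
    exact hAB (sub_self _)
  have hst : B / (B - A) + -A / (B - A) = 1 := by field_simp; ring
  have hs : 0 ≤ B / (B - A) := by
    have : B / (B - A) = (B * B - A * B) / (B - A) ^ 2 := by field_simp
    rw [this]
    exact div_nonneg (by nlinarith [mul_self_nonneg B]) (sq_nonneg _)
  have ht : 0 ≤ -A / (B - A) := by
    have : -A / (B - A) = (A * A - A * B) / (B - A) ^ 2 := by field_simp; ring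
    rw [this]
    exact div_nonneg (by nlinarith [mul_self_nonneg A]) (sq_nonneg _)
  have hz := convex_normSq_lt_one (normSq_klein_lt_one huD) (normSq_klein_lt_one hvD) hs ht hst
  have hw := kleinInv_mem hz
  have hKw := klein_kleinInv hz
  refine disjoint_left.1 hd (hmem _ hw ?_) (hG'.mem_of_combo hu hv huv hw hst hKw.symm)
  rw [hKw, signedArea_combo _ _ _ _ hst, ← hA, ← hB]
  field_simp
  ring

/-- A bounded open set whose frontier lies in a closed convex set lies in this convex set. -/
lemma subset_of_frontier_subset {E : Type*} [NormedAddCommGroup E] [NormedSpace ℝ E] {U C : Set E}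
    (hU : IsOpen U) (hc : IsCompact (closure U)) (hC : Convex ℝ C) (hCc : IsClosed C)
    (hne : C.Nonempty) (h : frontier U ⊆ C) : U ⊆ C := by
  intro x hx
  by_contra hxC
  obtain ⟨f, u, hfu, hux⟩ := geometric_hahn_banach_closed_point hC hCc hxC
  obtain ⟨y, hy, hmax⟩ := hc.exists_isMaxOn ⟨x, subset_closure hx⟩ f.continuous.continuousOn
  have hyU : y ∈ U := by
    by_contra hyU
    have hyf : y ∈ frontier U := by rw [hU.frontier_eq]; exact ⟨hy, hyU⟩
    have h1 := hfu y (h hyf)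
    have h2 := hmax (subset_closure hx)
    simp only [mem_ofPred_eq] at h2
    linarith
  have hloc : IsLocalMax f y :=
    hmax.isLocalMax (mem_of_superset (hU.mem_nhds hyU) subset_closure)
  have h0 := hloc.fderiv_eq_zero
  rw [f.fderiv] at h0
  obtain ⟨c, hcC⟩ := hne
  have h1 := hfu c hcC
  rw [h0] at h1 hux
  simp only [zero_apply] at h1 hux
  linarith

/-- The properties of a convex quadrilateral domain with vertices `a, b, c, d` in this order
used below. -/
structure IsPlaneQuadrilateral (U : Set ℂ) (a b c d : ℂ) : Prop where
  isOpen : IsOpen U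
  convex : Convex ℝ U
  nonempty : U.Nonempty
  subset_hull : U ⊆ convexHull ℝ {a, b, c, d}
  vertices : {a, b, c, d} ⊆ closure U
  side_bc : ∀ z ∈ openSegment ℝ b c, z ∉ U
  side_da : ∀ z ∈ openSegment ℝ d a, z ∉ U

lemma isPlaneQuadrilateral {Ω g₁ e₁ g₂ e₂ : Set ℂ} {p₁ q₁ p₂ q₂ : ℂ}
    (h : IsQuadrilateral Ω g₁ e₁ g₂ e₂ p₁ q₁ p₂ q₂) :
    IsPlaneQuadrilateral (klein '' Ω) (klein p₁) (klein q₁) (klein p₂) (klein q₂) := by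
  have hΩD : Ω ⊆ hDisk := subset_closure.trans h.inDisk
  have hfD : frontier Ω ⊆ hDisk := frontier_subset_closure.trans h.inDisk
  obtain ⟨hp₁, hq₁, -, hg₁⟩ := h.sideg₁.eq_segment
  obtain ⟨-, hp₂, hqp, he₁⟩ := h.sidee₁.eq_segment
  obtain ⟨-, hq₂, -, hg₂⟩ := h.sideg₂.eq_segment
  obtain ⟨-, -, -, he₂⟩ := h.sidee₂.eq_segment
  have himage : klein '' Ω = {k | Complex.normSq k < 1} ∩ kleinInv ⁻¹' Ω := by
    ext k
    constructor
    · rintro ⟨w, hw, rfl⟩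
      exact ⟨normSq_klein_lt_one (hΩD hw), by rwa [mem_preimage, kleinInv_klein (hΩD hw)]⟩
    · rintro ⟨hk, hw⟩
      exact ⟨_, hw, klein_kleinInv hk⟩
  have hopen : IsOpen (klein '' Ω) := by
    rw [himage, setOf_normSq_lt_one]
    exact Metric.isOpen_ball.inter (h.isOpen.preimage continuous_kleinInv)
  have hcompact : IsCompact (closure Ω) := by
    refine Metric.isCompact_of_isClosed_isBounded isClosed_closure
      ((Metric.isBounded_ball (x := (0 : ℂ)) (r := 2)).subset fun w hw => ?_)
    have hw4 : Complex.normSq w < 4 := h.inDisk hw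
    rw [Complex.normSq_eq_norm_sq] at hw4
    rw [mem_ball_zero_iff]
    nlinarith [norm_nonneg w]
  have hclosure : klein '' closure Ω = closure (klein '' Ω) :=
    image_closure_of_isCompact hcompact continuous_klein.continuousOn
  have hfrontier : frontier (klein '' Ω) = klein '' frontier Ω := by
    rw [hopen.frontier_eq, ← hclosure, h.isOpen.frontier_eq,
      (klein_injOn.mono h.inDisk).image_sdiff_subset subset_closure]
  have hdisj : ∀ z ∈ frontier (klein '' Ω), z ∉ klein '' Ω := fun z hz => by
    rw [hopen.frontier_eq] at hz
    exact hz.2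
  have hside : ∀ {x y : ℂ} {A : Set ℂ}, x ∈ hDisk → y ∈ hDisk →
      A = {w | w ∈ hDisk ∧ klein w ∈ openSegment ℝ (klein x) (klein y)} → A ⊆ frontier Ω →
      ∀ z ∈ openSegment ℝ (klein x) (klein y), z ∉ klein '' Ω := by
    intro x y A hx hy hA hAf z hz
    have hz1 := convex_normSq_lt_one.openSegment_subset (normSq_klein_lt_one hx)
      (normSq_klein_lt_one hy) hz
    refine hdisj z ?_
    rw [hfrontier]
    refine ⟨kleinInv z, hAf ?_, klein_kleinInv hz1⟩
    rw [hA]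
    exact ⟨kleinInv_mem hz1, by rwa [klein_kleinInv hz1]⟩
  have hvert : {klein p₁, klein q₁, klein p₂, klein q₂} = klein '' {p₁, q₁, p₂, q₂} := by
    simp [image_insert_eq]
  refine ⟨hopen, ?_, ?_, ?_, ?_, ?_, ?_⟩
  · rw [convex_iff_openSegment_subset]
    rintro _ ⟨x, hx, rfl⟩ _ ⟨y, hy, rfl⟩
    rcases eq_or_ne x y with rfl | hxy
    · rw [openSegment_same, singleton_subset_iff]
      exact mem_image_of_mem _ hx
    · obtain ⟨A, hA⟩ := exists_isGeodesicArc (hΩD hx) (hΩD hy) hxy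
      have hAΩ := h.convex x hx y hy A hA
      intro z hz
      have hz1 := convex_normSq_lt_one.openSegment_subset (normSq_klein_lt_one (hΩD hx))
        (normSq_klein_lt_one (hΩD hy)) hz
      refine ⟨kleinInv z, hAΩ ?_, klein_kleinInv hz1⟩
      rw [hA.eq_segment.2.2.2]
      exact ⟨kleinInv_mem hz1, by rwa [klein_kleinInv hz1]⟩
  · rw [image_nonempty, nonempty_iff_ne_empty]
    intro h0
    have := h.bdry
    rw [h0, frontier_empty] at this
    exact notMem_empty p₁ (this ▸ Or.inr (Or.inl rfl))
  · have hsub : ∀ {x y : ℂ} {A : Set ℂ}, x ∈ ({p₁, q₁, p₂, q₂} : Set ℂ) →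
        y ∈ ({p₁, q₁, p₂, q₂} : Set ℂ) →
        A = {w | w ∈ hDisk ∧ klein w ∈ openSegment ℝ (klein x) (klein y)} →
        ∀ w ∈ A, klein w ∈ convexHull ℝ {klein p₁, klein q₁, klein p₂, klein q₂} := by
      intro x y A hx hy hA w hw
      rw [hA] at hw
      rw [hvert]
      exact (convex_convexHull ℝ _).openSegment_subset
        (subset_convexHull ℝ _ (mem_image_of_mem _ hx))
        (subset_convexHull ℝ _ (mem_image_of_mem _ hy)) hw.2
    refine subset_of_frontier_subset hopen ?_ (convex_convexHull ℝ _)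
      ((toFinite _).isCompact_convexHull ℝ).isClosed
      ⟨klein p₁, subset_convexHull ℝ _ (by simp)⟩ ?_
    · rw [← hclosure]
      exact hcompact.image continuous_klein
    · rw [hfrontier, h.bdry]
      rintro _ ⟨w, (((hw | hw) | hw) | hw) | hw, rfl⟩
      · exact hsub (by simp) (by simp) hg₁ w hw
      · exact hsub (by simp) (by simp) he₁ w hw
      · exact hsub (by simp) (by simp) hg₂ w hw
      · exact hsub (by simp) (by simp) he₂ w hw
      · rw [hvert]
        exact subset_convexHull ℝ _ (mem_image_of_mem _ hw)
  · rw [hvert, ← hclosure]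
    refine image_mono (subset_union_right.trans (h.bdry.symm.subset.trans frontier_subset_closure))
  · refine hside hq₁ hp₂ he₁ ?_
    rw [h.bdry]
    exact fun w hw => Or.inl (Or.inl (Or.inl (Or.inr hw)))
  · refine hside hq₂ hp₁ he₂ ?_
    rw [h.bdry]
    exact fun w hw => Or.inl (Or.inr hw)

/-- The sides `bc` and `da` of a convex quadrilateral do not cross. -/
lemma IsPlaneQuadrilateral.not_cross {U : Set ℂ} {a b c d : ℂ}
    (h : IsPlaneQuadrilateral U a b c d) {z : ℂ} (h1 : z ∈ openSegment ℝ b c)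
    (h2 : z ∈ openSegment ℝ d a) : False := by
  obtain ⟨f, hf⟩ := geometric_hahn_banach_open_point h.convex h.isOpen (h.side_bc z h1)
  have hle : ∀ x ∈ closure U, f x ≤ f z := fun x hx =>
    closure_minimal (fun y hy => (hf y hy).le) (isClosed_le f.continuous continuous_const) hx
  have key : ∀ {x y : ℂ}, x ∈ closure U → y ∈ closure U → z ∈ openSegment ℝ x y →
      f z ≤ f x ∧ f z ≤ f y := by
    rintro x y hx hy ⟨s, t, hs, ht, hst, hz⟩
    have hfz : s * f x + t * f y = f z := by
      rw [← hz, map_add, map_smul, map_smul, smul_eq_mul, smul_eq_mul]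
    have hx' := hle x hx
    have hy' := hle y hy
    obtain rfl : s = 1 - t := by linarith
    constructor
    · by_contra! hlt
      nlinarith [mul_lt_mul_of_pos_left hlt hs, mul_le_mul_of_nonneg_left hy' ht.le]
    · by_contra! hlt
      nlinarith [mul_lt_mul_of_pos_left hlt ht, mul_le_mul_of_nonneg_left hx' hs.le]
  have hb := key (h.vertices (by simp)) (h.vertices (by simp)) h1
  have hd := key (h.vertices (by simp)) (h.vertices (by simp)) h2
  have hsub : convexHull ℝ {a, b, c, d} ⊆ {x | f z ≤ f x} := by
    refine convexHull_min ?_ (convex_halfSpace_ge f.toLinearMap.isLinear _)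
    rintro x (rfl | rfl | rfl | rfl)
    exacts [hd.2, hb.1, hb.2, hd.1]
  obtain ⟨x, hx⟩ := h.nonempty
  exact (hf x hx).not_ge (hsub (h.subset_hull hx))

lemma div_add_pos_of_mul_pos {x y : ℝ} (h : 0 < x * y) : 0 < x / (x + y) := by
  rcases pos_and_pos_or_neg_and_neg_of_mul_pos h with ⟨hx, hy⟩ | ⟨hx, hy⟩
  · positivity
  · exact div_pos_of_neg_of_neg hx (add_neg hx hy)

lemma mul_neg_of_mul_pos_of_mul_neg {x y z : ℝ} (hxy : 0 < x * y) (hxz : x * z < 0) :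
    y * z < 0 := by
  by_contra! h
  nlinarith [mul_nonneg (sq_nonneg x) h, mul_neg_of_pos_of_neg hxy hxz]

lemma IsPlaneQuadrilateral.orientation {U : Set ℂ} {a b c d : ℂ}
    (h : IsPlaneQuadrilateral U a b c d) (hab : 0 < signedArea a b c * signedArea a b d)
    (hcd : 0 < signedArea c d a * signedArea c d b) :
    0 < signedArea a b c * signedArea c d a := by
  by_contra! hle
  have hsum : signedArea c d b + -signedArea a b c = signedArea c d a + -signedArea a b d := by
    simp only [signedArea]; ring
  have hrel : signedArea c d b • a + -signedArea a b c • d =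
      signedArea c d a • b + -signedArea a b d • c := by
    apply Complex.ext <;> simp only [signedArea, Complex.add_re, Complex.add_im, Complex.smul_re,
      Complex.smul_im, smul_eq_mul] <;> ring
  set A := signedArea a b c
  set B := signedArea a b d
  set C := signedArea c d a
  set D := signedArea c d b
  have hAC : A * C < 0 := hle.lt_of_ne
    (mul_ne_zero (left_ne_zero_of_mul hab.ne') (left_ne_zero_of_mul hcd.ne'))
  have hBC := mul_neg_of_mul_pos_of_mul_neg hab hAC
  have hDA := mul_neg_of_mul_pos_of_mul_neg hcd (mul_comm A C ▸ hAC)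
  have hne : ∀ {x y : ℝ}, 0 < x * y → x + y ≠ 0 := fun hxy h0 => by
    have := div_add_pos_of_mul_pos hxy
    rw [h0, div_zero] at this
    exact this.false
  have key : ∀ {x y : ℝ} {v w : ℂ}, 0 < x * y → (x + y)⁻¹ • (x • v + y • w) ∈ openSegment ℝ v w :=
    fun {x y v w} hxy => by
      refine ⟨x / (x + y), y / (x + y), div_add_pos_of_mul_pos hxy, ?_, ?_, ?_⟩
      · rw [add_comm x]
        exact div_add_pos_of_mul_pos (mul_comm x y ▸ hxy)
      · rw [← add_div, div_self (hne hxy)]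
      · rw [smul_add, smul_smul, smul_smul, div_eq_inv_mul, div_eq_inv_mul]
  have h1 := key (x := C) (y := -B) (v := b) (w := c) (by linarith)
  have h2 := key (x := D) (y := -A) (v := a) (w := d) (by linarith)
  rw [hrel, hsum, openSegment_symm] at h2
  exact h.not_cross h1 h2

/-- A convex quadrilateral is determined by its vertices. -/
lemma IsPlaneQuadrilateral.subset_of_vertices {U V : Set ℂ} {a b c d a' b' c' d' : ℂ}
    (hU : IsPlaneQuadrilateral U a b c d) (hV : IsPlaneQuadrilateral V a' b' c' d')
    (h : ({a, b, c, d} : Set ℂ) ⊆ closure V) : U ⊆ V := by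
  have hVi : (interior V).Nonempty := by
    rw [hV.isOpen.interior_eq]
    exact hV.nonempty
  have h1 : U ⊆ closure V := hU.subset_hull.trans (convexHull_min h hV.convex.closure)
  have h2 := interior_maximal h1 hU.isOpen
  rwa [hV.convex.interior_closure_eq_interior_of_nonempty_interior hVi, hV.isOpen.interior_eq] at h2

lemma mem_segment_of_mem_convexHull {a b c d p : ℂ} (hp : p ∈ convexHull ℝ {a, b, c, d})
    (h0 : signedArea a b p = 0) (hcd : 0 < signedArea a b c * signedArea a b d) :
    p ∈ segment ℝ a b := by
  rw [← convexJoin_segments, mem_convexJoin] at hp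
  obtain ⟨x, hx, y, ⟨u, v, hu, hv, huv, rfl⟩, s, t, -, -, hst, rfl⟩ := hp
  have hx0 : signedArea a b x = 0 := by
    obtain ⟨u', v', -, -, huv', rfl⟩ := hx
    rw [signedArea_combo _ _ _ _ huv']
    simp only [signedArea]; ring
  rw [signedArea_combo _ _ _ _ hst, signedArea_combo _ _ _ _ huv, hx0, mul_zero, zero_add,
    mul_eq_zero] at h0
  rcases h0 with rfl | h0
  · rw [add_zero] at hst
    rwa [hst, one_smul, zero_smul, add_zero]
  · exfalso
    set C := signedArea a b c
    set D := signedArea a b d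
    have hC : 0 < C ^ 2 := by have := left_ne_zero_of_mul hcd.ne'; positivity
    have hmin : 0 < u * C ^ 2 + v * (C * D) := by
      rcases hu.eq_or_lt with rfl | hu
      · rw [zero_add] at huv
        rw [huv]; linarith
      · nlinarith [mul_pos hu hC, mul_nonneg hv hcd.le]
    nlinarith [congrArg (· * C) h0]

lemma exists_ratio_of_mem_segment {a b p q : ℂ} (hp : p ∈ segment ℝ a b)
    (hq : q ∈ segment ℝ a b) :
    ∃ r : ℝ, (∀ z, signedArea p q z = r * signedArea a b z) ∧ (0 < r → q ∈ segment ℝ p b) ∧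
      (r < 0 → q ∈ segment ℝ p a) := by
  obtain ⟨s', s, hs', hs, hss, rfl⟩ := hp
  obtain ⟨t', t, ht', ht, htt, rfl⟩ := hq
  obtain rfl : s' = 1 - s := by linarith
  obtain rfl : t' = 1 - t := by linarith
  refine ⟨t - s, fun z => ?_, fun hr => ?_, fun hr => ?_⟩
  · simp only [signedArea, Complex.add_re, Complex.add_im, Complex.smul_re, Complex.smul_im,
      smul_eq_mul]
    ring
  · have h1 : 0 < 1 - s := by linarith
    refine ⟨(1 - t) / (1 - s), (t - s) / (1 - s), by positivity, by positivity, ?_, ?_⟩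
    · field_simp; ring
    · refine smul_right_injective _ h1.ne' ?_
      simp only [smul_add, smul_smul, mul_div_cancel₀ _ h1.ne']
      rw [← mul_assoc, mul_div_cancel₀ _ h1.ne', ← mul_assoc, mul_div_cancel₀ _ h1.ne']
      module
  · have h1 : 0 < s := by linarith
    refine ⟨t / s, (s - t) / s, by positivity, div_nonneg (by linarith) h1.le, ?_, ?_⟩
    · field_simp; ring
    · refine smul_right_injective _ h1.ne' ?_
      simp only [smul_add, smul_smul, mul_div_cancel₀ _ h1.ne']
      rw [← mul_assoc, mul_div_cancel₀ _ h1.ne', ← mul_assoc, mul_div_cancel₀ _ h1.ne']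
      module

lemma IsCompleteGeodesic.signedArea_eq_zero {G : Set ℂ} (hG : IsCompleteGeodesic G) {x y u : ℂ}
    (hx : x ∈ G) (hy : y ∈ G) (hu : u ∈ G) : signedArea (klein x) (klein y) (klein u) = 0 := by
  obtain ⟨γ, hγ, hiso, rfl⟩ := hG
  obtain ⟨s, rfl⟩ := hx
  obtain ⟨t, rfl⟩ := hy
  obtain ⟨r, rfl⟩ := hu
  rcases lt_trichotomy s t with hst | rfl | hst
  · obtain ⟨a, b, hab, h⟩ := geodesic_combo hγ hiso hst r
    rw [← h, signedArea_combo _ _ _ _ hab]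
    simp only [signedArea]; ring
  · simp only [signedArea]; ring
  · obtain ⟨a, b, hab, h⟩ := geodesic_combo hγ hiso hst r
    rw [← h, signedArea_combo _ _ _ _ hab]
    simp only [signedArea]; ring

/-- Comparison of the alternating perimeters of two nested quadrilaterals with opposite sides on
two disjoint geodesics. -/
lemma hDist_add_lt_of_nested {G G' : Set ℂ} (hG : IsCompleteGeodesic G)
    (hG' : IsCompleteGeodesic G') (hd : Disjoint G G') {P Q p q P' Q' p' q' : ℂ}
    (hP : P ∈ G) (hQ : Q ∈ G) (hp : p ∈ G) (hq : q ∈ G)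
    (hP' : P' ∈ G') (hQ' : Q' ∈ G') (hp' : p' ∈ G') (hq' : q' ∈ G')
    (hpK : klein p ∈ segment ℝ (klein P) (klein Q)) (hqK : klein q ∈ segment ℝ (klein p) (klein Q))
    (hpK' : klein p' ∈ segment ℝ (klein P') (klein Q'))
    (hqK' : klein q' ∈ segment ℝ (klein p') (klein Q'))
    (hreg : hDist p q + hDist p' q' = hDist q p' + hDist q' p)
    (hne : ¬ (P = p ∧ Q = q ∧ P' = p' ∧ Q' = q')) :
    hDist Q P' + hDist Q' P < hDist P Q + hDist P' Q' := by
  have hGD := hG.subset_hDisk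
  have hGD' := hG'.subset_hDisk
  have h1 := (hDist_add_iff (hGD hP) (hGD hQ) (hGD hp)).2 hpK
  have h2 := (hDist_add_iff (hGD hp) (hGD hQ) (hGD hq)).2 hqK
  have h1' := (hDist_add_iff (hGD' hP') (hGD' hQ') (hGD' hp')).2 hpK'
  have h2' := (hDist_add_iff (hGD' hp') (hGD' hQ') (hGD' hq')).2 hqK'
  have c1 := hDist_comm (hGD hQ) (hGD hq)
  have c2 := hDist_comm (hGD hP) (hGD hp)
  have c1' := hDist_comm (hGD' hQ') (hGD' hq')
  have c2' := hDist_comm (hGD' hP') (hGD' hp')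
  have le1 := hDist_broken_le (hGD hQ) (hGD hq) (hGD' hP') (hGD' hp')
  have le2 := hDist_broken_le (hGD' hQ') (hGD' hq') (hGD hP) (hGD hp)
  by_cases h : Q = q ∧ P' = p'
  · have := hDist_broken_lt hG' hG hd.symm hQ' hq' hP hp (by tauto)
    linarith
  · have := hDist_broken_lt hG hG' hd hQ hq hP' hp' (by tauto)
    linarith

lemma mul_pos_of_mul_pos_of_ratio {r r' x x' y y' : ℝ} (hxx : 0 < x * x') (hyy : 0 < y * y')
    (hxy : 0 < x * y) (h : 0 < r * x' * (r' * y')) : 0 < r * r' := by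
  have h1 : 0 < r * r' * (x * x' * (y * y')) ^ 2 := by
    have := mul_pos (mul_pos h hxy) (mul_pos hxx hyy)
    linarith
  exact pos_of_mul_pos_left h1 (sq_nonneg _)

/-- Lemma 5.1. Any quadrilateral `Ω` with two sides on the
geodesics `γ̂₁, γ̂₂` strictly containing the regular quadrilateral `Ω₀` (whose side
lengths satisfy `ℓ(γ′₁)+ℓ(γ′₂) = ℓ(η′₁)+ℓ(η′₂)`) satisfies
`ℓ(γ₁)+ℓ(γ₂) > ℓ(η₁)+ℓ(η₂)`. -/
theorem statement_19 (G₁ H₁ G₂ H₂ Ωhat : Set ℂ) (ph₁ qh₁ ph₂ qh₂ : ℂ)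
    (hquad : IsIdealQuadrilateral Ωhat G₁ H₁ G₂ H₂ ph₁ qh₁ ph₂ qh₂)
    (hup : Ultraparallel G₁ G₂)
    (hd : setDistH G₁ G₂ < setDistH H₁ H₂)
    -- `η̂₁₂`, the common perpendicular of `η̂₁` and `η̂₂`
    (E12 : Set ℂ) (hE12 : IsCompleteGeodesic E12)
    (hperpH₁ : PerpGeodesics E12 H₁) (hperpH₂ : PerpGeodesics E12 H₂)
    -- the regular compact quadrilateral `Ω₀`
    (Ω₀ g₁' e₁' g₂' e₂' : Set ℂ) (p₁' q₁' p₂' q₂' : ℂ)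
    (hΩ₀ : IsQuadrilateral Ω₀ g₁' e₁' g₂' e₂' p₁' q₁' p₂' q₂')
    (hg₁' : g₁' ⊆ G₁) (hg₂' : g₂' ⊆ G₂)
    -- its other two sides lie on complete geodesics orthogonal to `η̂₁₂`
    (E₁' E₂' : Set ℂ) (hE₁' : IsCompleteGeodesic E₁') (hE₂' : IsCompleteGeodesic E₂')
    (hE : E₁' ≠ E₂') (he₁' : e₁' ⊆ E₁') (he₂' : e₂' ⊆ E₂')
    (hperpE₁ : PerpGeodesics E₁' E12) (hperpE₂ : PerpGeodesics E₂' E12)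
    -- all four sides at the same distance `dist(O, γ̂₁)` from the center `O`
    (O : ℂ) (hO : O ∈ hDisk) (hOE : O ∈ E12)
    (hdist₁ : setDistH {O} g₁' = setDistH {O} G₁)
    (hdist₂ : setDistH {O} g₂' = setDistH {O} G₁)
    (hdist₃ : setDistH {O} e₁' = setDistH {O} G₁)
    (hdist₄ : setDistH {O} e₂' = setDistH {O} G₁)
    -- so that `ℓ(γ′₁)+ℓ(γ′₂) = ℓ(η′₁)+ℓ(η′₂)`
    (hreg : hDist p₁' q₁' + hDist p₂' q₂' = hDist q₁' p₂' + hDist q₂' p₁') :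
    ∀ (Ω g₁ e₁ g₂ e₂ : Set ℂ) (P₁ Q₁ P₂ Q₂ : ℂ),
      IsQuadrilateral Ω g₁ e₁ g₂ e₂ P₁ Q₁ P₂ Q₂ →
      g₁ ⊆ G₁ → g₂ ⊆ G₂ → Ω₀ ⊆ Ω → Ω₀ ≠ Ω →
      hDist Q₁ P₂ + hDist Q₂ P₁ < hDist P₁ Q₁ + hDist P₂ Q₂ := by
  intro Ω g₁ e₁ g₂ e₂ P₁ Q₁ P₂ Q₂ hΩ hg₁ hg₂ hsub hne
  have hG₁ := hquad.geo₁
  have hG₂ := hquad.geo₂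
  have hdisj : Disjoint G₁ G₂ :=
    (disjoint_iff_inter_eq_empty.2 hup).mono subset_closure subset_closure
  obtain ⟨mP₁, mQ₁⟩ := hG₁.endpoints_mem hΩ.sideg₁ hg₁
  obtain ⟨mP₂, mQ₂⟩ := hG₂.endpoints_mem hΩ.sideg₂ hg₂
  obtain ⟨mp₁, mq₁⟩ := hG₁.endpoints_mem hΩ₀.sideg₁ hg₁'
  obtain ⟨mp₂, mq₂⟩ := hG₂.endpoints_mem hΩ₀.sideg₂ hg₂'
  have nPQ₁ := hΩ.sideg₁.eq_segment.2.2.1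
  have nPQ₂ := hΩ.sideg₂.eq_segment.2.2.1
  have npq₁ := hΩ₀.sideg₁.eq_segment.2.2.1
  have npq₂ := hΩ₀.sideg₂.eq_segment.2.2.1
  have hU := isPlaneQuadrilateral hΩ
  have hU₀ := isPlaneQuadrilateral hΩ₀
  have side₁ {u v : ℂ} (hu : u ∈ G₂) (hv : v ∈ G₂) :=
    signedArea_mul_pos hG₁ hG₂ hdisj mP₁ mQ₁ nPQ₁ hu hv
  have side₂ {u v : ℂ} (hu : u ∈ G₁) (hv : v ∈ G₁) :=
    signedArea_mul_pos hG₂ hG₁ hdisj.symm mP₂ mQ₂ nPQ₂ hu hv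
  have hhull : ({klein p₁', klein q₁', klein p₂', klein q₂'} : Set ℂ) ⊆
      convexHull ℝ {klein P₁, klein Q₁, klein P₂, klein Q₂} :=
    hU₀.vertices.trans (closure_minimal ((image_mono hsub).trans hU.subset_hull)
      ((toFinite _).isCompact_convexHull ℝ).isClosed)
  have hhull' : ({klein p₁', klein q₁', klein p₂', klein q₂'} : Set ℂ) ⊆
      convexHull ℝ {klein P₂, klein Q₂, klein P₁, klein Q₁} := by
    have : ({klein P₂, klein Q₂, klein P₁, klein Q₁} : Set ℂ) =
        {klein P₁, klein Q₁, klein P₂, klein Q₂} := by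
      ext; simp only [mem_insert_iff, mem_singleton_iff]; tauto
    rwa [this]
  have sp₁ := mem_segment_of_mem_convexHull (hhull (by simp))
    (hG₁.signedArea_eq_zero mP₁ mQ₁ mp₁) (side₁ mP₂ mQ₂)
  have sq₁ := mem_segment_of_mem_convexHull (hhull (by simp))
    (hG₁.signedArea_eq_zero mP₁ mQ₁ mq₁) (side₁ mP₂ mQ₂)
  have sp₂ := mem_segment_of_mem_convexHull (hhull' (by simp))
    (hG₂.signedArea_eq_zero mP₂ mQ₂ mp₂) (side₂ mP₁ mQ₁)
  have sq₂ := mem_segment_of_mem_convexHull (hhull' (by simp))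
    (hG₂.signedArea_eq_zero mP₂ mQ₂ mq₂) (side₂ mP₁ mQ₁)
  obtain ⟨r₁, hr₁, pos₁, neg₁⟩ := exists_ratio_of_mem_segment sp₁ sq₁
  obtain ⟨r₂, hr₂, pos₂, neg₂⟩ := exists_ratio_of_mem_segment sp₂ sq₂
  have hr : 0 < r₁ * r₂ := by
    have h1 := hU.orientation (side₁ mP₂ mQ₂) (side₂ mP₁ mQ₁)
    have h2 := hU₀.orientation (signedArea_mul_pos hG₁ hG₂ hdisj mp₁ mq₁ npq₁ mp₂ mq₂)
      (signedArea_mul_pos hG₂ hG₁ hdisj.symm mp₂ mq₂ npq₂ mp₁ mq₁)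
    rw [hr₁, hr₂] at h2
    exact mul_pos_of_mul_pos_of_ratio (side₁ mP₂ mp₂) (side₂ mP₁ mp₁) h1 h2
  have hvert : ¬ ({klein P₁, klein Q₁, klein P₂, klein Q₂} : Set ℂ) ⊆
      {klein p₁', klein q₁', klein p₂', klein q₂'} := fun h => by
    have h1 := hU.subset_of_vertices hU₀ (h.trans hU₀.vertices)
    rw [klein_injOn.image_subset_image_iff (subset_closure.trans hΩ.inDisk)
      (subset_closure.trans hΩ₀.inDisk)] at h1
    exact hne (hsub.antisymm h1)
  rcases pos_and_pos_or_neg_and_neg_of_mul_pos hr with ⟨h1, h2⟩ | ⟨h1, h2⟩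
  · refine hDist_add_lt_of_nested hG₁ hG₂ hdisj mP₁ mQ₁ mp₁ mq₁ mP₂ mQ₂ mp₂ mq₂
      sp₁ (pos₁ h1) sp₂ (pos₂ h2) hreg ?_
    rintro ⟨rfl, rfl, rfl, rfl⟩
    exact hvert subset_rfl
  · have key := hDist_add_lt_of_nested hG₁ hG₂ hdisj mQ₁ mP₁ mp₁ mq₁ mQ₂ mP₂ mp₂ mq₂
      (segment_symm ℝ (klein P₁) _ ▸ sp₁) (neg₁ h1) (segment_symm ℝ (klein P₂) _ ▸ sp₂) (neg₂ h2)
      hreg ?_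
    · have hGD := hG₁.subset_hDisk
      have hGD' := hG₂.subset_hDisk
      rw [hDist_comm (hGD mP₁) (hGD' mQ₂), hDist_comm (hGD' mP₂) (hGD mQ₁),
        hDist_comm (hGD mQ₁) (hGD mP₁), hDist_comm (hGD' mQ₂) (hGD' mP₂)] at key
      linarith
    · rintro ⟨rfl, rfl, rfl, rfl⟩
      refine hvert fun x => ?_
      simp only [mem_insert_iff, mem_singleton_iff]
      tauto

end
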